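/- Racah relation for the normalized q-Racah polynomials: for all integers i, x with 0 ≤ i ≤ N and 0 ≤ x ≤ N, one has Σ_{n=0}^{N} [ω_n(c₁c₂)/ξ_n(c₁,c₂)]·[ω_i(c₂c₃)/ξ_i(c₂,c₃)]·[ω_x(c₃c₁)/ξ_x(c₃,c₁)]·p_i(n;c₁,c₂,c₃;N)·p_n(x;c₃,c₁,c₂;N) = ω_N(qc₁c₂c₃)·p_i(x;c₁,c₃,c₂;N). -/

import Mathlib

noncomputable section
namespace qR

/-- q-Pochhammer symbol `(a;q)_k = ∏_{l<k} (1 - a qˡ)`. -/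
def poch (q a : ℂ) (k : ℕ) : ℂ := ∏ l ∈ Finset.range k, (1 - a * q ^ l)

/-- q-binomial coefficient, zero outside `0 ≤ n ≤ N`. -/
def binom (q : ℂ) (N n : ℤ) : ℂ :=
  if 0 ≤ n ∧ n ≤ N then poch q q N.toNat / (poch q q n.toNat * poch q q (N - n).toNat) else 0

/-- Normalisation `Ω(n;c1,c2,c3;N)`; `s` and `t2` are the chosen square roots of `q` and `c2`,
so that `(q c2)^(n - N/2) = (s t2)^(2n - N)`. -/
def Om (q s c1 c2 c3 t2 : ℂ) (N n : ℤ) : ℂ :=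
  binom q N n * (1 - c2 * c3 * q ^ (2 * n + 1)) * poch q (q * c2) n.toNat
      * poch q (c1 * c2 * c3 * q ^ (N + 2)) n.toNat * poch q (q * c1) (N - n).toNat
    / ((s * t2) ^ (2 * n - N) * poch q (c2 * c3 * q ^ (n + 1)) (N + 1).toNat
        * poch q (q * c3) n.toNat)

/-- Normalised q-Racah polynomial `p_n(x;c1,c2,c3;N)`, with the convention that it
vanishes unless `0 ≤ n ≤ N` and `0 ≤ x ≤ N`. -/
def p (q s c1 c2 c3 t2 : ℂ) (N n x : ℤ) : ℂ :=
  if 0 ≤ n ∧ n ≤ N ∧ 0 ≤ x ∧ x ≤ N then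
    Om q s c1 c2 c3 t2 N n *
      ∑ k ∈ Finset.range (n.toNat + 1),
        poch q (q ^ (-n)) k * poch q (c2 * c3 * q ^ (n + 1)) k * poch q (q ^ (-x)) k
            * poch q (c1 * c2 * q ^ (x + 1)) k * q ^ k
          / (poch q (q * c2) k * poch q (c1 * c2 * c3 * q ^ (N + 2)) k
              * poch q (q ^ (-N)) k * poch q q k)
  else 0

/-- `ω_n(c) = (-1)^n c^{n/2} q^{n(n+1)/2}`, where `r` is the chosen square root of `c`. -/
def om (q r : ℂ) (n : ℤ) : ℂ := (-1 : ℂ) ^ n * r ^ n * q ^ (n * (n + 1) / 2)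

/-- `ξ_n(c1,c2) = ((qc1;q)_n/(qc2;q)_n) (c2/c1)^{n/2}`, where `t1, t2` are the chosen
square roots of `c1, c2`. -/
def xi (q c1 c2 t1 t2 : ℂ) (n : ℤ) : ℂ :=
  poch q (q * c1) n.toNat / poch q (q * c2) n.toNat * (t2 / t1) ^ n

/-- `λ(x;c) = -(1-q^{-x})(1-c q^{x+1})`. -/
def lam (q c : ℂ) (x : ℤ) : ℂ := -(1 - q ^ (-x)) * (1 - c * q ^ (x + 1))

def PhiP (q c1 c2 c3 : ℂ) (N n : ℤ) : ℂ :=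
  -c2 * q ^ (n - N) * (1 - q ^ n) * (1 - c1 * q ^ (N - n + 1)) * (1 - c2 * c3 * q ^ (n + N + 1))
      * (1 - c3 * q ^ n)
    / ((1 - c2 * c3 * q ^ (2 * n)) * (1 - c2 * c3 * q ^ (2 * n + 1)))

def PhiM (q c1 c2 c3 : ℂ) (N n : ℤ) : ℂ :=
  (1 - q ^ (n - N)) * (1 - c1 * c2 * c3 * q ^ (n + N + 2)) * (1 - c2 * q ^ (n + 1))
      * (1 - c2 * c3 * q ^ (n + 1))
    / ((1 - c2 * c3 * q ^ (2 * n + 1)) * (1 - c2 * c3 * q ^ (2 * n + 2)))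

/-- `Φ^ε(n;c1,c2,c3;N)`, where `ε = 1, -1, 0` selects `Φ⁺, Φ⁻, Φ⁰`. -/
def Phi (q c1 c2 c3 : ℂ) (N ε n : ℤ) : ℂ :=
  if ε = 1 then PhiP q c1 c2 c3 N n
  else if ε = -1 then PhiM q c1 c2 c3 N n
  else -PhiP q c1 c2 c3 N n - PhiM q c1 c2 c3 N n

/-- `λ₊(x;c1,c2,c3;N)`. -/
def lamP (q c1 c2 c3 : ℂ) (N x : ℤ) : ℂ :=
  -(q ^ (-N - 1) / c3 - q ^ (-x)) * (1 - c1 * c2 * c3 * q ^ (N + x + 2))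

/-- `λ₋(x;c1,c2,c3;N)`. -/
def lamM (q c1 c2 c3 : ℂ) (N x : ℤ) : ℂ :=
  -(q ^ (-N) - q ^ (-x)) * (1 - c1 * c2 * q ^ (N + x + 1))

def PhiPp (q sq c1 c2 c3 : ℂ) (N n : ℤ) : ℂ :=
  -sq * c2 * q ^ (2 * n - N - 1) * (1 - q ^ n) * (1 - c1 * q ^ (N - n + 1))
      * (1 - c1 * q ^ (N + 2 - n)) * (1 - c3 * q ^ n)
    / ((1 - c2 * c3 * q ^ (2 * n)) * (1 - c2 * c3 * q ^ (2 * n + 1)))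

def PhiPm (q sq c1 c2 c3 : ℂ) (N n : ℤ) : ℂ :=
  -((1 - c1 * c2 * c3 * q ^ (n + N + 2)) * (1 - c1 * c2 * c3 * q ^ (n + N + 3))
      * (1 - c2 * q ^ (n + 1)) * (1 - c2 * c3 * q ^ (n + 1)))
    / (c3 * q ^ (N + 1) * sq * (1 - c2 * c3 * q ^ (2 * n + 1)) * (1 - c2 * c3 * q ^ (2 * n + 2)))

def PhiP0 (q sq c1 c2 c3 : ℂ) (N n : ℤ) : ℂ :=
  -PhiPp q sq c1 c2 c3 N n - PhiPm q sq c1 c2 c3 N n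
    - (1 - c1 * c2 * q ^ (N + 2)) * (1 - c1 * c2 * c3 * q ^ (N + 2)) / (c3 * q ^ (N + 1) * sq)

def PhiMp (q sq c1 c2 c3 : ℂ) (N n : ℤ) : ℂ :=
  -sq * (1 - q ^ n) * (1 - c3 * q ^ n) * (1 - c2 * c3 * q ^ (n + N))
      * (1 - c2 * c3 * q ^ (n + N + 1))
    / (q ^ N * (1 - c2 * c3 * q ^ (2 * n)) * (1 - c2 * c3 * q ^ (2 * n + 1)))

def PhiMm (q sq c1 c2 c3 : ℂ) (N n : ℤ) : ℂ :=
  -c3 * sq * q ^ N * (1 - q ^ (n - N)) * (1 - q ^ (n - N + 1)) * (1 - c2 * q ^ (n + 1))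
      * (1 - c2 * c3 * q ^ (n + 1))
    / ((1 - c2 * c3 * q ^ (2 * n + 1)) * (1 - c2 * c3 * q ^ (2 * n + 2)))

def PhiM0 (q sq c1 c2 c3 : ℂ) (N n : ℤ) : ℂ :=
  -PhiMp q sq c1 c2 c3 N n - PhiMm q sq c1 c2 c3 N n - sq * (1 - c3 * q ^ N) * (q ^ (-N) - 1)

/-- Contiguity coefficient `Φ_σ^ε(n;c1,c2,c3;N)`, where `σ = 1` is the `+` and `σ = -1`
the `-` family, `ε ∈ {1,0,-1}` selects the superscript, and `sq` is the chosen square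
root of `q c2`. -/
def PhiC (q sq c1 c2 c3 : ℂ) (σ ε N n : ℤ) : ℂ :=
  if σ = 1 then
    if ε = 1 then PhiPp q sq c1 c2 c3 N n
    else if ε = -1 then PhiPm q sq c1 c2 c3 N n
    else PhiP0 q sq c1 c2 c3 N n
  else
    if ε = 1 then PhiMp q sq c1 c2 c3 N n
    else if ε = -1 then PhiMm q sq c1 c2 c3 N n
    else PhiM0 q sq c1 c2 c3 N n

def Fp (q c1 c2 : ℂ) (x : ℤ) : ℂ :=
  c1 * c2 ^ 2 * q ^ (x + 1) * (1 - c1 * q ^ x) * (1 - q ^ x)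
    / ((1 - c1 * c2 * q ^ (2 * x)) * (1 - c1 * c2 * q ^ (2 * x + 1)))

def Fm (q c1 c2 : ℂ) (x : ℤ) : ℂ :=
  c1 * c2 * q ^ (x + 1) * (1 - c2 * q ^ (x + 1)) * (1 - c1 * c2 * q ^ (x + 1))
    / ((1 - c1 * c2 * q ^ (2 * x + 1)) * (1 - c1 * c2 * q ^ (2 * x + 2)))

/-- The coefficients `A^{ε,ε'}_{i,j}(c1,c2,c3,c4;N)` for `(ε,ε') ≠ (0,0)`;
`t2` is the chosen square root of `c2` and the fifth parameter
`c0 = (q^{2N+3} c1 c2 c3 c4)⁻¹` is computed internally. -/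
def Aaux (q s c1 c2 c3 c4 t2 : ℂ) (N ε ε' i j : ℤ) : ℂ :=
  if ε' = 1 ∨ ε' = -1 then
    -c3 * q ^ (N + 1) *
        (if ε' = 1 then Fp q c4 ((q ^ (2 * N + 3) * c1 * c2 * c3 * c4)⁻¹) j
         else Fm q c4 ((q ^ (2 * N + 3) * c1 * c2 * c3 * c4)⁻¹) j) *
        PhiC q (s * t2) c1 c2 c3 ε' ε (N - j) i
  else if ε = 1 ∨ ε = -1 then
    c3 * q ^ (N + 1) *
        (Fp q c4 ((q ^ (2 * N + 3) * c1 * c2 * c3 * c4)⁻¹) j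
          + Fm q c4 ((q ^ (2 * N + 3) * c1 * c2 * c3 * c4)⁻¹) j) *
        Phi q c1 c2 c3 (N - j) ε i
  else 0

/-- The coefficients `A^{ε,ε'}_{i,j}(c1,c2,c3,c4;N)`. -/
def A (q s c1 c2 c3 c4 t2 : ℂ) (N ε ε' i j : ℤ) : ℂ :=
  if ε = 0 ∧ ε' = 0 then
    -((1 - c3 * q ^ (N + 1 - j)) * (s * t2) / (1 - c1 * c2 * q ^ (N + 2 - j)))
          * ∑ e ∈ ({-1, 0, 1} : Finset ℤ), Aaux q s c1 c2 c3 c4 t2 N e 1 i j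
      - (1 - c1 * c2 * q ^ (N + 1 - j)) / ((1 - c3 * q ^ (N - j)) * (s * t2))
          * ∑ e ∈ ({-1, 0, 1} : Finset ℤ), Aaux q s c1 c2 c3 c4 t2 N e (-1) i j
      - ∑ e ∈ ({-1, 1} : Finset ℤ), Aaux q s c1 c2 c3 c4 t2 N e 0 i j
  else Aaux q s c1 c2 c3 c4 t2 N ε ε' i j

/-- `Λ(x;c1,c2,c3,c4;N)`; `s, t1, t2, t3, t4` are the chosen square roots of
`q, c1, c2, c3, c4`. -/
def Lam (q s c1 c2 c3 c4 t1 t2 t3 t4 : ℂ) (N x : ℤ) : ℂ :=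
  (-1 : ℂ) ^ x * binom q N x * (1 - c1 * c2 * q ^ (2 * x + 1)) * poch q (q * c2) x.toNat
      * (s * t2) ^ N * (t1 * t3 / (t2 * t4)) ^ x * q ^ (x * (x - 1) / 2)
    / (poch q (q * c1) x.toNat * poch q (q ^ (x + 1) * c1 * c2) (N + 1).toNat)

/-- Tratnik polynomial of q-Racah type `T_{i,j}(x,y;c1,c2,c3,c4;N)`; the fifth parameter
`c0 = (q^{2N+3} c1 c2 c3 c4)⁻¹` and its square root `t0 = (s^{2N+3} t1 t2 t3 t4)⁻¹`
are computed internally. -/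
def T (q s c1 c2 c3 c4 t1 t2 t3 t4 : ℂ) (N i j x y : ℤ) : ℂ :=
  if 0 ≤ i ∧ 0 ≤ j ∧ i + j ≤ N then
    p q s c1 c2 c3 t2 (N - j) i x *
      p q s c3 ((q ^ (2 * N + 3) * c1 * c2 * c3 * c4)⁻¹) c4
        ((s ^ (2 * N + 3) * t1 * t2 * t3 * t4)⁻¹) (N - x) j y
  else 0

/-- Griffiths polynomial of q-Racah type `G_{i,j}(x,y;c1,c2,c3,c4;N)`; the fifth parameter
`c0 = (q^{2N+3} c1 c2 c3 c4)⁻¹` and its square root `t0 = (s^{2N+3} t1 t2 t3 t4)⁻¹`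
are computed internally. -/
def G (q s c1 c2 c3 c4 t1 t2 t3 t4 : ℂ) (N i j x y : ℤ) : ℂ :=
  if 0 ≤ i ∧ 0 ≤ j ∧ i + j ≤ N then
    ∑ a ∈ Finset.range ((min (N - j) (N - y)).toNat + 1),
      om q (t1 * t2 * t3 / t4) (a : ℤ) * p q s c1 c2 c3 t2 (N - j) i (a : ℤ) *
        p q s c3 ((q ^ (2 * N + 3) * c1 * c2 * c3 * c4)⁻¹) c4
          ((s ^ (2 * N + 3) * t1 * t2 * t3 * t4)⁻¹) (N - (a : ℤ)) j y *
        p q s c4 c2 c1 t2 (N - y) (a : ℤ) x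
  else 0

end qR

namespace qRS
open qR Finset

def T (q : ℂ) (n : ℕ) : ℂ := ∏ l ∈ range n, q ^ l

lemma T_zero (q : ℂ) : T q 0 = 1 := by simp [T]
lemma T_succ (q : ℂ) (n : ℕ) : T q (n+1) = T q n * q ^ n := by simp [T, prod_range_succ]
lemma T_ne {q : ℂ} (hq : q ≠ 0) (n : ℕ) : T q n ≠ 0 := by
  unfold T; exact prod_ne_zero_iff.mpr fun l _ => pow_ne_zero _ hq
lemma T_add (q : ℂ) (m n : ℕ) : T q (m+n) = T q m * T q n * q ^ (m*n) := by
  induction n with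
  | zero => simp [T_zero]
  | succ n ih => rw [← add_assoc, T_succ, T_succ, ih]; ring
lemma T_sq (q : ℂ) (n : ℕ) : T q n * T q n * q ^ n = q ^ (n*n) := by
  induction n with
  | zero => simp [T_zero]
  | succ n ih =>
    rw [T_succ]
    calc _ = (T q n * T q n * q ^ n) * (q ^ n * q ^ (n+1)) * 1 * 1 := by ring
      _ = _ := by rw [ih]; ring

lemma poch_zero (q a : ℂ) : poch q a 0 = 1 := by simp [poch]
lemma poch_succ (q a : ℂ) (k : ℕ) : poch q a (k+1) = poch q a k * (1 - a * q ^ k) := by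
  simp [poch, prod_range_succ]
lemma poch_succ' (q a : ℂ) (k : ℕ) : poch q a (k+1) = (1 - a) * poch q (a * q) k := by
  simp only [poch, prod_range_succ']
  rw [mul_comm]; simp [pow_succ, mul_assoc, mul_comm, mul_left_comm]
lemma poch_add (q a : ℂ) (m n : ℕ) :
    poch q a (m+n) = poch q a m * poch q (a * q ^ m) n := by
  induction n with
  | zero => simp [poch_zero]
  | succ n ih => rw [← add_assoc, poch_succ, poch_succ, ih]; ring
lemma poch_ne {q a : ℂ} {k : ℕ} (h : ∀ t < k, 1 - a * q ^ t ≠ 0) : poch q a k ≠ 0 := by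
  unfold poch; exact prod_ne_zero_iff.mpr fun l hl => h l (mem_range.mp hl)
lemma poch_ne_le {q a : ℂ} {k m : ℕ} (h : poch q a k ≠ 0) (hm : m ≤ k) : poch q a m ≠ 0 := by
  obtain ⟨r, rfl⟩ := Nat.exists_eq_add_of_le hm
  rw [poch_add] at h; exact left_ne_zero_of_mul h
lemma poch_ne_fac {q a : ℂ} {k m : ℕ} (h : poch q a k ≠ 0) (hm : m < k) :
    1 - a * q ^ m ≠ 0 := by
  have := poch_ne_le h (Nat.succ_le_of_lt hm)
  rw [Nat.succ_eq_add_one, poch_succ] at this; exact right_ne_zero_of_mul this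
lemma poch_ne_shift {q a : ℂ} {k m : ℕ} (h : poch q a (m+k) ≠ 0) :
    poch q (a * q ^ m) k ≠ 0 := by
  rw [poch_add] at h; exact right_ne_zero_of_mul h
lemma poch_inv_zero {q : ℂ} (hq : q ≠ 0) {n k : ℕ} (h : n < k) : poch q ((q ^ n)⁻¹) k = 0 := by
  unfold poch
  refine prod_eq_zero (mem_range.mpr h) ?_
  have := pow_ne_zero n hq
  field_simp; simp

/-- reversal -/
lemma poch_rev {q a : ℂ} (hq : q ≠ 0) (ha : a ≠ 0) (n : ℕ) :
    poch q ((a * q ^ n)⁻¹) n = poch q (q * a) n * (-1) ^ n / (a ^ n * T q (n+1)) := by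
  have hT := T_ne hq
  induction n with
  | zero => simp [poch_zero, T_zero, T_succ]
  | succ n ih =>
    rw [poch_succ', poch_succ, T_succ]
    have : (a * q ^ (n+1))⁻¹ * q = (a * q ^ n)⁻¹ := by
      have := pow_ne_zero n hq
      rw [pow_succ]; field_simp
    rw [this, ih]
    have h1 := hT (n+1)
    have := pow_ne_zero n hq
    rw [pow_succ q n, pow_succ a n, pow_succ (-1 : ℂ) n]
    field_simp
    ring

lemma poch_inv {q : ℂ} (hq : q ≠ 0) (m k : ℕ) (h : poch q q m ≠ 0) :
    poch q ((q ^ (m+k))⁻¹) k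
      = poch q q (m+k) * (-1) ^ k * T q k / (poch q q m * q ^ ((m + k) * k)) := by
  have h1 := poch_rev hq (pow_ne_zero m hq) k
  rw [← pow_add] at h1
  rw [h1, poch_add, T_succ]
  have h2 := T_sq q k
  have hT := T_ne hq k
  have : (q ^ m) ^ k * (T q k * q ^ k) * T q k = q ^ ((m+k)*k) := by
    rw [add_mul, pow_add, ← h2]; ring
  rw [← this]
  have := pow_ne_zero k hq
  have := pow_ne_zero m hq
  field_simp

lemma anti_split (n : ℕ) (H F G : ℕ → ℕ → ℂ)
    (h : ∀ l m, l + m = n + 1 → H l m = F l m + G l m)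
    (hF : ∀ m, F 0 m = 0) (hG : ∀ l, G l 0 = 0) :
    ∑ p ∈ antidiagonal (n+1), H p.1 p.2
      = ∑ p ∈ antidiagonal n, (F (p.1+1) p.2 + G p.1 (p.2+1)) := by
  rw [sum_congr rfl (fun p hp => h p.1 p.2 (mem_antidiagonal.mp hp)), sum_add_distrib,
    sum_add_distrib]
  congr 1
  · rw [Nat.sum_antidiagonal_succ]; simp [hF]
  · rw [Nat.sum_antidiagonal_succ']; simp [hG]

def B (q : ℂ) (a b : ℕ) : ℂ := poch q q (a+b) / (poch q q a * poch q q b)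

/-- general weighted Pascal rule -/
lemma pascal (q : ℂ) (n : ℕ) (hn : poch q q (n+1) ≠ 0) (c X Y Z : ℕ → ℕ → ℂ)
    (h : ∀ l m, l + m = n + 1 →
      (1 - q ^ (n+1)) * Z l m = (1 - q ^ l) * X l m + (1 - q ^ m) * Y l m) :
    ∑ p ∈ antidiagonal (n+1), B q p.1 p.2 * Z p.1 p.2
      = ∑ p ∈ antidiagonal n, B q p.1 p.2 * (X (p.1+1) p.2 + Y p.1 (p.2+1)) := by
  rw [anti_split n (fun l m => B q l m * Z l m)
    (fun l m => poch q q n / (poch q q l * poch q q m) * ((1 - q ^ l) * X l m))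
    (fun l m => poch q q n / (poch q q l * poch q q m) * ((1 - q ^ m) * Y l m))]
  · refine sum_congr rfl fun p hp => ?_
    obtain ⟨l, m⟩ := p
    have hp : l + m = n := by simpa using hp
    simp only [B, hp]
    have e1 := poch_ne_fac hn (show l < n+1 by omega)
    have e2 := poch_ne_fac hn (show m < n+1 by omega)
    have e3 := poch_ne_le hn (show l ≤ n+1 by omega)
    have e4 := poch_ne_le hn (show m ≤ n+1 by omega)
    rw [poch_succ, poch_succ, pow_succ' q l, pow_succ' q m]
    field_simp
  · intro l m hlm
    have e3 := poch_ne_le hn (show l ≤ n+1 by omega)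
    have e4 := poch_ne_le hn (show m ≤ n+1 by omega)
    simp only [B, hlm]
    rw [poch_succ, ← pow_succ', ← mul_add, ← h l m hlm]
    field_simp
  · simp
  · simp

/-- Saalschuetz connection -/
lemma saal (q β u v : ℂ) (hq : q ≠ 0) (hβ : β ≠ 0) (n : ℕ) (hn : poch q q n ≠ 0)
    (hz : poch q (β * u * v) n ≠ 0) :
    ∑ p ∈ antidiagonal n, B q p.1 p.2 * (β⁻¹ ^ p.1 * poch q β⁻¹ p.2 * poch q (β * u) p.1
      * poch q (β * v) p.1 / poch q (β * u * v) p.1)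
    = poch q u n * poch q v n / poch q (β * u * v) n := by
  induction n with
  | zero => simp [poch_zero, B]
  | succ n ih =>
    have hzn := poch_ne_fac hz (Nat.lt_succ_self n)
    set c : ℕ → ℕ → ℂ := fun l m => β⁻¹ ^ l * poch q β⁻¹ m * poch q (β * u) l
      * poch q (β * v) l / poch q (β * u * v) l with hc
    have ih := ih (poch_ne_le hn (by omega)) (poch_ne_le hz (by omega))
    change ∑ p ∈ antidiagonal (n+1), B q p.1 p.2 * c p.1 p.2 = _
    change ∑ p ∈ antidiagonal n, B q p.1 p.2 * c p.1 p.2 = _ at ih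
    rw [pascal q n hn c
      (fun l m => q ^ m * (1 - β * u * v * (q ^ l * q⁻¹)) * c l m / (1 - β * u * v * q ^ n))
      (fun l m => (1 - β * u * v * (q ^ n * q ^ l)) * c l m / (1 - β * u * v * q ^ n))]
    · rw [poch_succ, poch_succ, poch_succ]
      have : poch q u n * (1 - u * q ^ n) * (poch q v n * (1 - v * q ^ n)) /
          (poch q (β * u * v) n * (1 - β * u * v * q ^ n)) =
          (poch q u n * poch q v n / poch q (β * u * v) n) *
            ((1 - u * q ^ n) * (1 - v * q ^ n) / (1 - β * u * v * q ^ n)) := by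
        have := poch_ne_le hz (show n ≤ n+1 by omega)
        field_simp
      rw [this, ← ih, sum_mul]
      refine sum_congr rfl fun p hp => ?_
      obtain ⟨l, m⟩ := p
      have hp : l + m = n := by simpa using hp
      have e1 := poch_ne_fac hz (show l < n+1 by omega)
      have e2 := poch_ne_le hz (show l ≤ n+1 by omega)
      simp only [hc, poch_succ]
      subst hp
      have := pow_ne_zero l hβ
      simp only [inv_pow, pow_succ]
      field_simp
      ring
    · intro l m hlm
      have : q ^ n = q ^ l * q ^ m * q⁻¹ := by
        rw [← pow_add, hlm, pow_succ]; field_simp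
      rw [this] at hzn
      rw [pow_succ, this]
      have e : q⁻¹ * q = 1 := inv_mul_cancel₀ hq
      generalize q⁻¹ = r at *
      rw [mul_assoc (q ^ l * q ^ m), e]
      simp only [← mul_div_assoc]
      rw [← add_div, eq_div_iff hzn]
      ring

lemma vand (q A : ℂ) (n : ℕ) (hn : poch q q n ≠ 0) (y : ℂ) :
    ∑ p ∈ antidiagonal n, B q p.1 p.2 * ((-y) ^ p.1 * T q p.1 * poch q A p.1
      * poch q (A * y * q ^ p.1) p.2) = poch q y n := by
  induction n generalizing y with
  | zero => simp [poch_zero, B, T_zero]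
  | succ n ih =>
    have ih := ih (poch_ne_le hn (by omega)) (y * q)
    set c : ℕ → ℕ → ℂ := fun l m => (-y) ^ l * T q l * poch q A l
      * poch q (A * y * q ^ l) m with hc
    change ∑ p ∈ antidiagonal (n+1), B q p.1 p.2 * c p.1 p.2 = _
    rw [pascal q n hn c c (fun l m => q ^ l * c l m)]
    · rw [poch_succ', ← ih, mul_sum]
      refine sum_congr rfl fun p hp => ?_
      obtain ⟨l, m⟩ := p
      simp only [hc, poch_succ q A, poch_succ' q (A * y * q ^ l), T_succ]
      rw [show A * y * q ^ (l+1) = A * y * q ^ l * q by ring,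
        show A * (y * q) * q ^ l = A * y * q ^ l * q by ring,
        show (-(y * q)) ^ l = (-y) ^ l * q ^ l by rw [← mul_pow]; ring]
      ring
    · intro l m hlm
      rw [← hlm]; ring

/-- second form of q-Vandermonde -/
lemma vand2 (q X : ℂ) (n : ℕ) (hn : poch q q n ≠ 0) (b : ℂ) :
    ∑ p ∈ antidiagonal n, B q p.1 p.2 * ((-1) ^ p.1 * T q p.2 * poch q X p.1
      * poch q (b * q ^ p.1) p.2) = T q n * ∏ t ∈ range n, (X - b * q ^ t) := by
  induction n generalizing b with
  | zero => simp [poch_zero, B, T_zero]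
  | succ n ih =>
    have ih := ih (poch_ne_le hn (by omega)) (b * q)
    set c : ℕ → ℕ → ℂ := fun l m => (-1) ^ l * T q m * poch q X l
      * poch q (b * q ^ l) m with hc
    change ∑ p ∈ antidiagonal (n+1), B q p.1 p.2 * c p.1 p.2 = _
    rw [pascal q n hn c (fun l m => q ^ m * c l m) c]
    · have : T q (n+1) * ∏ t ∈ range (n+1), (X - b * q ^ t)
          = q ^ n * (X - b) * (T q n * ∏ t ∈ range n, (X - b * q * q ^ t)) := by
        rw [T_succ, prod_range_succ', pow_zero, mul_one,
          prod_congr rfl (fun t _ => show X - b * q ^ (t+1) = X - b * q * q ^ t by ring)]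
        ring
      rw [this, ← ih, mul_sum]
      refine sum_congr rfl fun p hp => ?_
      obtain ⟨l, m⟩ := p
      have hp : l + m = n := by simpa using hp
      subst hp
      simp only [hc, poch_succ q X, poch_succ' q (b * q ^ l), T_succ]
      rw [show b * q ^ (l+1) = b * q ^ l * q by ring,
        show b * q * q ^ l = b * q ^ l * q by ring]
      ring
    · intro l m hlm
      rw [← hlm]; ring

/-- limit of the terminating 6phi5 sum -/
lemma vwp (q D : ℂ) (n : ℕ) (hn : poch q q n ≠ 0) (A : ℂ) (hA : poch q A (2*n+1) ≠ 0) :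
    ∑ p ∈ antidiagonal n, B q p.1 p.2 * ((-1) ^ p.1 * T q p.1 * (1 - A * q ^ (2 * p.1))
      * poch q (A * D * q ^ n) p.1 * poch q D p.2 / poch q (A * q ^ p.1) (n+1))
      = (-D) ^ n * T q n := by
  induction n generalizing A with
  | zero =>
    have : 1 - A ≠ 0 := by simpa [poch] using hA
    simp [poch, B, T_zero, this]
  | succ n ih =>
    have hA' : poch q (A * q) (2*n+1) ≠ 0 := by
      have := poch_ne_shift (m := 1) (k := 2*n+1) (poch_ne_le hA (by omega))
      simpa using this
    have ih := ih (poch_ne_le hn (by omega)) (A * q) hA'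
    set h : ℕ → ℕ → ℂ := fun l m => (-1) ^ l * T q l * poch q (A * D * q ^ (n+1)) l
      * poch q D m with hh
    have key := pascal q n hn h (fun l m => h l m / poch q (A * q ^ l) (n+1))
      (fun l m => q ^ l * h l m / poch q (A * q ^ (l+1)) (n+1))
      (fun l m => (-1) ^ l * T q l * (1 - A * q ^ (2 * l))
      * poch q (A * D * q ^ (n+1)) l * poch q D m / poch q (A * q ^ l) (n+1+1)) ?_
    · rw [key]
      have : (-D) ^ (n+1) * T q (n+1) = -D * q ^ n * ((-D) ^ n * T q n) := by
        rw [T_succ]; ring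
      rw [this, ← ih, mul_sum]
      refine sum_congr rfl fun p hp => ?_
      obtain ⟨l, m⟩ := p
      have hp : l + m = n := by simpa using hp
      subst hp
      simp only [hh, poch_succ q D, poch_succ q (A * D * q ^ (l + m + 1)), T_succ]
      rw [show A * q ^ (l+1) = A * q * q ^ l by ring,
        show A * q * D * q ^ (l+m) = A * D * q ^ (l+m+1) by ring]
      ring
    · intro l m hlm
      have e1 : poch q (A * q ^ l) (n+1+1) ≠ 0 :=
        poch_ne_shift (poch_ne_le hA (by omega))
      have e2 : poch q (A * q ^ l) (n+1+1)
        = (1 - A * q ^ l) * poch q (A * q ^ (l+1)) (n+1) := by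
        rw [poch_succ']; ring_nf
      have e3 : poch q (A * q ^ l) (n+1+1)
        = poch q (A * q ^ l) (n+1) * (1 - A * q ^ l * q ^ (n+1)) := poch_succ _ _ _
      have f2 := e1
      have f3 := e1
      rw [e2] at f2
      rw [e3] at f3
      have g2 := right_ne_zero_of_mul f2
      have g3 := left_ne_zero_of_mul f3
      have k2 : q ^ l * h l m / poch q (A * q ^ (l+1)) (n+1)
          = q ^ l * h l m * (1 - A * q ^ l) / poch q (A * q ^ l) (n+1+1) := by
        rw [e2, div_eq_div_iff g2 f2]; ring
      have k3 : h l m / poch q (A * q ^ l) (n+1)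
          = h l m * (1 - A * q ^ l * q ^ (n+1)) / poch q (A * q ^ l) (n+1+1) := by
        rw [e3, div_eq_div_iff g3 f3]; ring
      rw [k2, k3, ← hlm]
      simp only [hh, ← hlm]
      ring

end qRS

namespace qRS
open qR Finset

lemma anti_range (n : ℕ) (f : ℕ → ℕ → ℂ) :
    ∑ p ∈ antidiagonal n, f p.1 p.2 = ∑ k ∈ range (n+1), f k (n-k) :=
  Nat.sum_antidiagonal_eq_sum_range_succ f n

lemma vand_hyp (q A y : ℂ) (hq : q ≠ 0) (X : ℕ) (hX : poch q q X ≠ 0)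
    (hE : poch q (A * y) X ≠ 0) :
    ∑ k ∈ range (X+1), poch q ((q ^ X)⁻¹) k * poch q A k / (poch q (A * y) k * poch q q k)
      * (y * q ^ X) ^ k = poch q y X / poch q (A * y) X := by
  rw [← vand q A X hX y, anti_range X (fun l m => B q l m * ((-y) ^ l * T q l * poch q A l
      * poch q (A * y * q ^ l) m)), sum_div]
  refine sum_congr rfl fun k hk => ?_
  have hk : k ≤ X := by simpa [Nat.lt_succ_iff] using hk
  obtain ⟨m, rfl⟩ := Nat.exists_eq_add_of_le' hk
  rw [Nat.add_sub_cancel]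
  have h1 := poch_ne_le hX (show k ≤ m + k by omega)
  have h2 := poch_ne_le hX (show m ≤ m + k by omega)
  have h3 := poch_ne_le hE (show k ≤ m + k by omega)
  rw [poch_inv hq m k h2, B, add_comm k m]
  have e : poch q (A * y) (m + k) = poch q (A * y) k * poch q (A * y * q ^ k) m := by
    rw [add_comm, poch_add]
  rw [e] at hE ⊢
  have h4 := right_ne_zero_of_mul hE
  rw [mul_pow, ← pow_mul, neg_pow y k]
  have := pow_ne_zero ((m+k)*k) hq
  field_simp

/-- (q^{-k})_r / (q)_k -/
lemma inv_ratio (q : ℂ) (hq : q ≠ 0) (r m : ℕ) (h : poch q q (r + m) ≠ 0) :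
    poch q ((q ^ (r+m))⁻¹) r / poch q q (r+m)
      = (-1) ^ r * T q r / (poch q q m * q ^ (r * r) * (q ^ r) ^ m) := by
  have h2 := poch_ne_le h (show m ≤ r + m by omega)
  rw [add_comm r m] at *
  rw [poch_inv hq m r h2, show (m+r)*r = r*r + r*m by ring, pow_add, pow_mul q r m]
  field_simp

lemma vandS (q A y : ℂ) (hq : q ≠ 0) (X r : ℕ) (hX : poch q q X ≠ 0)
    (hE : poch q (A * y) X ≠ 0) :
    ∑ k ∈ range (X+1), poch q ((q ^ X)⁻¹) k * poch q A k / (poch q (A * y) k * poch q q k)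
      * (y * q ^ X) ^ k * poch q ((q ^ k)⁻¹) r
    = poch q ((q ^ X)⁻¹) r * poch q A r * poch q y (X - r) * (y * q ^ X) ^ r
        * ((-1) ^ r * T q r) / (q ^ (r*r) * poch q (A * y) X) := by
  rcases lt_or_ge X r with h | h
  · rw [poch_inv_zero hq h]
    simp only [zero_mul, zero_div]
    refine sum_eq_zero fun k hk => ?_
    rw [poch_inv_zero hq (show k < r by have := mem_range.mp hk; omega)]; simp
  obtain ⟨Y, rfl⟩ := Nat.exists_eq_add_of_le h
  rw [Nat.add_sub_cancel_left]
  have hE' := hE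
  rw [poch_add] at hE'
  have hE1 := left_ne_zero_of_mul hE'
  have hE2 := right_ne_zero_of_mul hE'
  have key := vand_hyp q (A * q ^ r) y hq Y (poch_ne_le hX (by omega))
    (by rw [show A * q ^ r * y = A * y * q ^ r by ring]; exact hE2)
  rw [show A * q ^ r * y = A * y * q ^ r by ring] at key
  rw [add_assoc, sum_range_add, sum_eq_zero, zero_add]
  · have : poch q ((q ^ (r+Y))⁻¹) r * poch q A r * poch q y Y * (y * q ^ (r+Y)) ^ r
        * ((-1) ^ r * T q r) / (q ^ (r*r) * poch q (A * y) (r+Y)) =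
        (poch q ((q ^ (r+Y))⁻¹) r * poch q A r * (y * q ^ (r+Y)) ^ r
        * ((-1) ^ r * T q r) / (q ^ (r*r) * poch q (A * y) r)) *
        (poch q y Y / poch q (A * y * q ^ r) Y) := by
      rw [poch_add q (A * y)]
      have := pow_ne_zero (r*r) hq
      field_simp
    rw [this, ← key, mul_sum]
    refine sum_congr rfl fun m hm => ?_
    have hm : m ≤ Y := by simpa [Nat.lt_succ_iff] using hm
    have e1 := inv_ratio q hq r m (poch_ne_le hX (by omega))
    have h4 := poch_ne_le hX (show r + m ≤ r + Y by omega)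
    have h5 := poch_ne_le hX (show m ≤ r + Y by omega)
    have h6 : poch q (A * y * q ^ r) m ≠ 0 := poch_ne_le hE2 (by omega)
    rw [div_eq_iff h4] at e1
    rw [e1]
    rw [poch_add q _ r m, poch_add q A r m, poch_add q (A*y) r m]
    have e2 : (q ^ (r+Y))⁻¹ * q ^ r = (q ^ Y)⁻¹ := by
      have := pow_ne_zero r hq
      have := pow_ne_zero Y hq
      rw [pow_add]; field_simp
    rw [e2]
    have e3 : (y * q ^ (r+Y)) ^ (r+m) = (y * q ^ (r+Y)) ^ r * (y * q ^ Y) ^ m * (q ^ r) ^ m := by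
      rw [pow_add, mul_assoc, ← mul_pow, pow_add q]; ring
    rw [e3]
    have := pow_ne_zero (r*r) hq
    have := pow_ne_zero m (pow_ne_zero r hq)
    field_simp
  · intro k hk
    rw [poch_inv_zero hq (mem_range.mp hk)]; simp

lemma vand2_hyp (q b X : ℂ) (hq : q ≠ 0) (N k : ℕ) (hk : k ≤ N) (hN : poch q q N ≠ 0)
    (hb : poch q b k ≠ 0) :
    (∏ t ∈ range k, (X - b * q ^ t)) / poch q b k
      = ∑ r ∈ range (N+1), poch q X r * q ^ r / (poch q q r * poch q b r)
          * poch q ((q ^ k)⁻¹) r := by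
  have hX := poch_ne_le hN hk
  have key := vand2 q X k hX b
  rw [anti_range k (fun l m => B q l m * ((-1) ^ l * T q m * poch q X l
      * poch q (b * q ^ l) m))] at key
  obtain ⟨M, rfl⟩ := Nat.exists_eq_add_of_le hk
  rw [show k + M + 1 = k + 1 + M by ring, sum_range_add, sum_eq_zero (s := range M), add_zero]
  · have hT := T_ne hq k
    rw [eq_comm, mul_comm, ← eq_div_iff hT] at key
    rw [key, sum_div, sum_div]
    refine sum_congr rfl fun r hr => ?_
    have hr : r ≤ k := by simpa [Nat.lt_succ_iff] using hr
    obtain ⟨m, rfl⟩ := Nat.exists_eq_add_of_le' hr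
    rw [Nat.add_sub_cancel]
    have h1 := poch_ne_le hX (show r ≤ m + r by omega)
    have h2 := poch_ne_le hX (show m ≤ m + r by omega)
    have h3 := poch_ne_le hb (show r ≤ m + r by omega)
    rw [poch_inv hq m r h2, B, add_comm r m]
    have e : poch q b (m + r) = poch q b r * poch q (b * q ^ r) m := by
      rw [add_comm, poch_add]
    rw [e] at hb ⊢
    have h4 := right_ne_zero_of_mul hb
    have t1 := T_sq q r
    rw [T_add] at hT ⊢
    rw [add_mul, pow_add, ← t1, pow_mul]
    rw [pow_mul] at hT
    have := T_ne hq m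
    have := T_ne hq r
    have := pow_ne_zero r (pow_ne_zero m hq)
    have := pow_ne_zero r hq
    field_simp
  · intro r _
    rw [poch_inv_zero hq (show k < k + 1 + r by omega)]; simp

lemma prod_flip (q b : ℂ) (hq : q ≠ 0) (l k : ℕ) :
    ∏ t ∈ range k, ((q ^ l)⁻¹ - b * q ^ t) = poch q (b * q ^ l) k * ((q ^ l)⁻¹) ^ k := by
  have := pow_ne_zero l hq
  rw [poch, ← card_range k, ← prod_const, card_range, ← prod_mul_distrib]
  refine prod_congr rfl fun t _ => ?_
  field_simp

/-- the 3phi2 transformation -/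
lemma tr3 (q A y b : ℂ) (hq : q ≠ 0) (N x l : ℕ) (hx : x ≤ N) (hN : poch q q N ≠ 0)
    (hb : poch q b N ≠ 0) (hE : poch q (A * y) x ≠ 0) :
    ∑ k ∈ range (x+1), poch q ((q ^ x)⁻¹) k * poch q A k * poch q (b * q ^ l) k
        / (poch q (A * y) k * poch q b k * poch q q k) * (y * q ^ x * (q ^ l)⁻¹) ^ k
    = ∑ r ∈ range (N+1), poch q ((q ^ l)⁻¹) r * q ^ r / (poch q q r * poch q b r) *
       (poch q ((q ^ x)⁻¹) r * poch q A r * poch q y (x - r) * (y * q ^ x) ^ r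
        * ((-1) ^ r * T q r) / (q ^ (r*r) * poch q (A * y) x)) := by
  have hx1 := poch_ne_le hN hx
  have : ∀ k ∈ range (x+1), poch q ((q ^ x)⁻¹) k * poch q A k * poch q (b * q ^ l) k
        / (poch q (A * y) k * poch q b k * poch q q k) * (y * q ^ x * (q ^ l)⁻¹) ^ k
      = ∑ r ∈ range (N+1), poch q ((q ^ l)⁻¹) r * q ^ r / (poch q q r * poch q b r) *
        (poch q ((q ^ x)⁻¹) k * poch q A k / (poch q (A * y) k * poch q q k)
      * (y * q ^ x) ^ k * poch q ((q ^ k)⁻¹) r) := by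
    intro k hk
    have hk : k ≤ x := by simpa [Nat.lt_succ_iff] using hk
    have e := vand2_hyp q b ((q ^ l)⁻¹) hq N k (by omega) hN (poch_ne_le hb (by omega))
    rw [prod_flip q b hq] at e
    rw [mul_pow (y * q ^ x)]
    calc _ = (poch q ((q ^ x)⁻¹) k * poch q A k / (poch q (A * y) k * poch q q k)
      * (y * q ^ x) ^ k) * (poch q (b * q ^ l) k * (q ^ l)⁻¹ ^ k / poch q b k) := by
          rw [mul_div_assoc', div_mul_eq_mul_div, div_mul_eq_mul_div, div_mul_eq_mul_div, div_div]
          congr 1 <;> ring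
      _ = _ := by
          rw [e, mul_sum]
          refine sum_congr rfl fun r _ => ?_
          ring
  rw [sum_congr rfl this, sum_comm]
  refine sum_congr rfl fun r _ => ?_
  rw [← mul_sum, vandS q A y hq x r hx1 hE]

end qRS

namespace qRS
open qR Finset

lemma saal_hyp (q β u v : ℂ) (hq : q ≠ 0) (hβ : β ≠ 0) (X : ℕ) (hX : poch q q X ≠ 0)
    (hz : poch q (β * u * v) X ≠ 0) (hi : poch q β⁻¹ X ≠ 0) :
    ∑ k ∈ range (X+1), poch q ((q ^ X)⁻¹) k * poch q (β * u) k * poch q (β * v) k * q ^ k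
      / (poch q (β * u * v) k * poch q (β * q / q ^ X) k * poch q q k)
    = poch q u X * poch q v X / (poch q (β * u * v) X * poch q β⁻¹ X) := by
  rw [← div_div, ← saal q β u v hq hβ X hX hz, anti_range X (fun l m => B q l m *
    (β⁻¹ ^ l * poch q β⁻¹ m * poch q (β * u) l * poch q (β * v) l / poch q (β * u * v) l)),
    sum_div]
  refine sum_congr rfl fun k hk => ?_
  have hk : k ≤ X := by simpa [Nat.lt_succ_iff] using hk
  obtain ⟨m, rfl⟩ := Nat.exists_eq_add_of_le' hk
  rw [Nat.add_sub_cancel]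
  have h1 := poch_ne_le hX (show k ≤ m + k by omega)
  have h2 := poch_ne_le hX (show m ≤ m + k by omega)
  have h3 := poch_ne_le hz (show k ≤ m + k by omega)
  have ha : q ^ m / (β * q) ≠ 0 := by
    have := pow_ne_zero m hq
    positivity
  have hr := poch_rev hq ha k
  have e1 : (q ^ m / (β * q) * q ^ k)⁻¹ = β * q / q ^ (m+k) := by
    have := pow_ne_zero m hq
    have := pow_ne_zero k hq
    rw [pow_add]; field_simp
  have e2 : q * (q ^ m / (β * q)) = β⁻¹ * q ^ m := by field_simp
  rw [e1, e2] at hr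
  rw [poch_inv hq m k h2, B, add_comm k m, hr, poch_add q β⁻¹ m k, T_succ]
  rw [poch_add] at hi
  have h4 := left_ne_zero_of_mul hi
  have h5 := right_ne_zero_of_mul hi
  have t1 := T_sq q k
  rw [add_mul, pow_add, ← t1, div_pow, mul_pow, pow_mul]
  have := T_ne hq k
  have := pow_ne_zero k (pow_ne_zero m hq)
  have := pow_ne_zero k hq
  have := pow_ne_zero k hβ
  have s1 : ((-1:ℂ) ^ k) ≠ 0 := pow_ne_zero _ (by norm_num)
  rw [inv_pow]
  clear hi hr e1 e2 ha
  generalize poch q β⁻¹ m = P1 at *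
  generalize poch q (β⁻¹ * q ^ m) k = P2 at *
  field_simp

lemma tri_sum (n : ℕ) (f : ℕ → ℕ → ℂ) :
    ∑ j ∈ range (n+1), ∑ p ∈ antidiagonal j, f p.1 p.2
      = ∑ l ∈ range (n+1), ∑ m ∈ range (n - l + 1), f l m := by
  rw [sum_sigma', sum_sigma']
  refine sum_bij' (fun p _ => ⟨p.2.1, p.2.2⟩) (fun p _ => ⟨p.1 + p.2, (p.1, p.2)⟩) ?_ ?_ ?_ ?_ ?_
  · rintro ⟨j, l, m⟩ h; simp at h ⊢; omega
  · rintro ⟨l, m⟩ h; simp at h ⊢; omega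
  · rintro ⟨j, l, m⟩ h; simp at h ⊢; omega
  · rintro ⟨l, m⟩ h; simp
  · rintro ⟨j, l, m⟩ h; simp

/-- Sears, raw form -/
lemma sears0 (q β u v a e f : ℂ) (hq : q ≠ 0) (hβ : β ≠ 0) (ha : a ≠ 0) (he : e ≠ 0)
    (i : ℕ) (hX : poch q q i ≠ 0)
    (hz : poch q (β * u * v) i ≠ 0) (hei : poch q e i ≠ 0) (hfi : poch q f i ≠ 0)
    (hg : poch q (e * β / a) i ≠ 0) (hf : f = a * q / (e * β * q ^ i)) :
    ∑ j ∈ range (i+1), poch q ((q ^ i)⁻¹) j * poch q a j * poch q u j * poch q v j * q ^ j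
      / (poch q e j * poch q (β * u * v) j * poch q f j * poch q q j)
    = ∑ l ∈ range (i+1), poch q ((q ^ i)⁻¹) l * poch q a l * q ^ l * β⁻¹ ^ l *
        poch q (β * u) l * poch q (β * v) l
        / (poch q f l * poch q q l * poch q (β * u * v) l) *
        (poch q (e * β * q ^ l) (i - l) * poch q (e / a) (i - l) /
          (poch q e i * poch q (e * β / a) (i - l))) := by
  have step : ∀ j ∈ range (i+1), poch q ((q ^ i)⁻¹) j * poch q a j * poch q u j * poch q v j * q ^ j
      / (poch q e j * poch q (β * u * v) j * poch q f j * poch q q j)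
      = ∑ p ∈ antidiagonal j, (fun l m => poch q ((q ^ i)⁻¹) (l+m) * poch q a (l+m) * q ^ (l+m)
        / (poch q e (l+m) * poch q f (l+m) * (poch q q l * poch q q m)) *
         (β⁻¹ ^ l * poch q β⁻¹ m * poch q (β * u) l * poch q (β * v) l / poch q (β * u * v) l))
          p.1 p.2 := by
    intro j hj
    have hj : j ≤ i := by simpa [Nat.lt_succ_iff] using hj
    have hjj := poch_ne_le hX hj
    have key := saal q β u v hq hβ j hjj (poch_ne_le hz hj)
    calc _ = poch q ((q ^ i)⁻¹) j * poch q a j * q ^ j / (poch q e j * poch q f j * poch q q j)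
          * (poch q u j * poch q v j / poch q (β * u * v) j) := by
            rw [div_mul_div_comm]; congr 1 <;> ring
      _ = _ := by
        rw [← key, mul_sum]
        refine sum_congr rfl fun p hp => ?_
        obtain ⟨l, m⟩ := p
        have hp : l + m = j := by simpa using hp
        simp only [hp, B]
        have h1 := poch_ne_le hjj (show l ≤ j by omega)
        have h2 := poch_ne_le hjj (show m ≤ j by omega)
        rw [← mul_assoc]
        congr 1
        field_simp
  rw [sum_congr rfl step]
  refine (tri_sum i (fun l m => poch q ((q ^ i)⁻¹) (l+m) * poch q a (l+m) * q ^ (l+m)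
        / (poch q e (l+m) * poch q f (l+m) * (poch q q l * poch q q m)) *
         (β⁻¹ ^ l * poch q β⁻¹ m * poch q (β * u) l * poch q (β * v) l
          / poch q (β * u * v) l))).trans ?_
  refine sum_congr rfl fun l hl => ?_
  have hl : l ≤ i := by simpa [Nat.lt_succ_iff] using hl
  obtain ⟨Y, rfl⟩ := Nat.exists_eq_add_of_le hl
  rw [Nat.add_sub_cancel_left]
  have h1 := poch_ne_le hX (show l ≤ l + Y by omega)
  have h2 := poch_ne_le hX (show Y ≤ l + Y by omega)
  have hql := pow_ne_zero l hq
  have hqY := pow_ne_zero Y hq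
  have key := saal_hyp q (a / (e * β)) (e * q ^ l * β) (e / a) hq (by positivity) Y h2
    (by
      rw [show a / (e * β) * (e * q ^ l * β) * (e / a) = e * q ^ l by field_simp]
      exact poch_ne_shift hei)
    (by
      rw [show (a / (e * β))⁻¹ = e * β / a by field_simp]
      exact poch_ne_le hg (by omega))
  rw [show a / (e * β) * (e * q ^ l * β) * (e / a) = e * q ^ l by field_simp,
    show (a / (e * β))⁻¹ = e * β / a by field_simp,
    show a / (e * β) * (e * q ^ l * β) = a * q ^ l by field_simp,
    show a / (e * β) * (e / a) = β⁻¹ by field_simp,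
    show a / (e * β) * q / q ^ Y = f * q ^ l by rw [hf, pow_add]; field_simp] at key
  rw [poch_add q e l Y] at hei ⊢
  have h3 := left_ne_zero_of_mul hei
  have h4 := right_ne_zero_of_mul hei
  have : poch q (e * β * q ^ l) Y * poch q (e / a) Y /
          (poch q e l * poch q (e * q ^ l) Y * poch q (e * β / a) Y)
       = (poch q e l)⁻¹ * (poch q (e * q ^ l * β) Y * poch q (e / a) Y /
          (poch q (e * q ^ l) Y * poch q (e * β / a) Y)) := by
    rw [show e * β * q ^ l = e * q ^ l * β by ring, inv_mul_eq_div, div_div]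
    congr 1; ring
  rw [this, ← key, mul_sum, mul_sum]
  refine sum_congr rfl fun m hm => ?_
  have e2 : (q ^ (l+Y))⁻¹ * q ^ l = (q ^ Y)⁻¹ := by
    rw [pow_add]; field_simp
  rw [poch_add q _ l m, poch_add q a l m, poch_add q e l m, poch_add q f l m, e2, pow_add q l m]
  simp only [div_eq_mul_inv, mul_inv]
  ring

end qRS

namespace qRS
open qR Finset

lemma poch_inv_ne {q : ℂ} (hq : q ≠ 0) {N k : ℕ} (h : poch q q N ≠ 0) (hk : k ≤ N) :
    poch q ((q ^ N)⁻¹) k ≠ 0 := by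
  obtain ⟨m, rfl⟩ := Nat.exists_eq_add_of_le' hk
  have h2 := poch_ne_le h (show m ≤ m + k by omega)
  rw [poch_inv hq m k h2]
  have := T_ne hq k
  have s1 : ((-1:ℂ) ^ k) ≠ 0 := pow_ne_zero _ (by norm_num)
  have := pow_ne_zero ((m+k)*k) hq
  positivity

/-- Sears, specialised -/
lemma searsF (q c2 c3 a b g : ℂ) (hq : q ≠ 0) (h2 : c2 ≠ 0) (h3 : c3 ≠ 0) (N i n : ℕ)
    (hi : i ≤ N) (hb' : b = a * (c3 * q ^ (N+1))) (hg' : g = c2 * c3 * q ^ (N+2))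
    (hN : poch q q N ≠ 0) (hb : poch q b N ≠ 0)
    (hc2 : poch q (q * c2) N ≠ 0) (hc3 : poch q (q * c3) N ≠ 0) (hg : poch q g N ≠ 0) :
    ∑ j ∈ range (i+1), poch q ((q ^ i)⁻¹) j * poch q (c2 * c3 * q ^ (i+1)) j *
        poch q ((q ^ n)⁻¹) j * poch q (a * q ^ n) j * q ^ j
      / (poch q (q * c2) j * poch q b j * poch q ((q ^ N)⁻¹) j * poch q q j)
    = poch q g i * poch q ((c3 * q ^ i)⁻¹) i * poch q q (N - i) /
        (poch q (q * c2) i * poch q q N) *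
      ∑ l ∈ range (i+1), poch q ((q ^ i)⁻¹) l * poch q (c2 * c3 * q ^ (i+1)) l * q ^ l
        / (poch q b l * poch q (q * c3) l * poch q g l * poch q q l) *
        (poch q (b * q ^ n) l * poch q (c3 * q ^ (N+1) * (q ^ n)⁻¹) l) := by
  have hqn := pow_ne_zero n hq
  have hqi := pow_ne_zero i hq
  have hqN := pow_ne_zero N hq
  have hA : c2 * c3 * q ^ (i+1) ≠ 0 := mul_ne_zero (mul_ne_zero h2 h3) (pow_ne_zero _ hq)
  have hβ : c3 * q ^ (N+1) ≠ 0 := mul_ne_zero h3 (pow_ne_zero _ hq)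
  have e0 : c3 * q ^ (N+1) * (q ^ n)⁻¹ * (a * q ^ n) = b := by rw [hb']; field_simp
  obtain ⟨M, rfl⟩ := Nat.exists_eq_add_of_le' hi
  have eg : q * c2 * (c3 * q ^ (M + i +1)) / (c2 * c3 * q ^ (i+1)) = q * q ^ M := by
    rw [pow_succ, pow_succ, pow_add]; field_simp
  have hsp := poch_add q q M i
  have key := sears0 q (c3 * q ^ (M + i+1)) ((q ^ n)⁻¹) (a * q ^ n) (c2 * c3 * q ^ (i+1))
    (q * c2) ((q ^ (M + i))⁻¹) hq hβ hA (mul_ne_zero hq h2) i (poch_ne_le hN hi)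
    (by rw [e0]; exact poch_ne_le hb hi) (poch_ne_le hc2 hi) (poch_inv_ne hq hN hi)
    (by rw [eg]; intro h; rw [hsp, h] at hN; simp at hN)
    (by rw [pow_succ, pow_succ, pow_add]; field_simp)
  rw [e0, eg] at key
  rw [key, mul_sum, Nat.add_sub_cancel]
  clear key
  refine sum_congr rfl fun l hl => ?_
  have hl : l ≤ i := by simpa [Nat.lt_succ_iff] using hl
  obtain ⟨m, rfl⟩ := Nat.exists_eq_add_of_le' hl
  rw [Nat.add_sub_cancel]
  have hN1 := poch_ne_le hN (show M + m ≤ M + (m + l) by omega)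
  have hN2 := poch_ne_le hN (show M ≤ M + (m + l) by omega)
  have hN3 := poch_ne_le hN (show l ≤ M + (m + l) by omega)
  have hb1 := poch_ne_le hb (show l ≤ M + (m + l) by omega)
  have hg1 := poch_ne_le hg (show l ≤ M + (m + l) by omega)
  have hc21 := poch_ne_le hc2 (show m + l ≤ M + (m + l) by omega)
  have hc31 := poch_ne_le hc3 (show l ≤ M + (m + l) by omega)
  have r1 : c3 * q ^ (M + (m + l) + 1) * (a * q ^ n) = b * q ^ n := by rw [hb']; ring
  have r2 : q * c2 * (c3 * q ^ (M + (m + l) + 1)) * q ^ l = g * q ^ l := by rw [hg']; ring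
  have r3 : q * c2 / (c2 * c3 * q ^ (m + l + 1)) = (c3 * q ^ (m+l))⁻¹ := by
    rw [pow_succ]; field_simp
  have r4 : poch q ((c3 * q ^ (m+l))⁻¹) (m + l)
      = poch q ((c3 * q ^ (m+l))⁻¹) m * (poch q (q*c3) l * (-1)^l / (c3 ^ l * T q (l+1))) := by
    rw [poch_add, ← poch_rev hq h3 l]
    congr 2
    rw [pow_add]; field_simp
  have r5 := poch_add q q M m
  have r6 : poch q g (m + l) = poch q g l * poch q (g * q ^ l) m := by
    rw [add_comm, poch_add]
  have r7 := poch_inv hq (M + m) l hN1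
  rw [← add_assoc M m l, r7, add_assoc M m l, r1, r2, r3, r4, r6]
  have hx : poch q (q * q ^ M) m = poch q q (M+m) / poch q q M := by
    rw [r5]; field_simp
  rw [hx, T_succ]
  clear hx r7 r6 r5 r4 r3 r2 r1 hsp eg e0 hb' hg' hA hβ hb hc2 hc3 hg
  generalize poch q b l = P1 at *
  generalize poch q g l = P2 at *
  generalize poch q (q*c2) (m+l) = P3 at *
  generalize poch q (q*c3) l = P4 at *
  generalize poch q (b * q ^ n) l = P5 at *
  generalize poch q (g * q ^ l) m = P6 at *
  generalize poch q ((c3 * q ^ (m + l))⁻¹) m = P7 at *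
  generalize poch q ((q ^ (m + l))⁻¹) l = P8 at *
  generalize poch q (c2 * c3 * q ^ (m + l + 1)) l = P9 at *
  generalize poch q (c3 * q ^ (M + (m + l) + 1) * (q ^ n)⁻¹) l = P10 at *
  have := T_ne hq l
  have s1 : ((-1:ℂ) ^ l) ≠ 0 := pow_ne_zero _ (by norm_num)
  rw [inv_pow, mul_pow, ← pow_mul, show (M + (m + l) + 1) * l = (M + (m + l)) * l + l by ring,
    pow_add q _ l]
  have := pow_ne_zero ((M + (m+l)) * l) hq
  have := pow_ne_zero l hq
  generalize q ^ ((M + (m+l)) * l) = P11 at *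
  have s2 : ((-1:ℂ) ^ l) ^ 2 = 1 := by rw [← pow_mul, mul_comm, pow_mul]; norm_num
  field_simp
  rw [s2]; ring

/-- the weight -/
def wt (q a b c3 : ℂ) (N n : ℕ) : ℂ :=
  B q n (N - n) * ((-1)^n * T q n * (1 - a * q ^ (2*n)) * poch q b n * poch q (q * c3) (N - n)
    / poch q (a * q ^ n) (N+1))

lemma Wlem (q a b c3 : ℂ) (hq : q ≠ 0) (h3 : c3 ≠ 0) (N k l : ℕ)
    (hk : k ≤ N) (hb' : b = a * (c3 * q ^ (N+1)))
    (hN : poch q q N ≠ 0) (hA : poch q a (2*N+1) ≠ 0) :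
    ∑ n ∈ range (N+1), wt q a b c3 N n *
      ((poch q (b * q ^ n) l * poch q (c3 * q ^ (N+1) * (q ^ n)⁻¹) l) *
       (poch q ((q^n)⁻¹) k * poch q (a * q ^ n) k))
    = poch q b (k+l) * poch q (q*c3) l * poch q ((q^N)⁻¹) k * (-(c3 * q ^ (l+1)))^N * T q N
      / (c3 * q ^ (l+1))^k := by
  obtain ⟨M, rfl⟩ := Nat.exists_eq_add_of_le hk
  rw [add_assoc k M 1, sum_range_add, sum_eq_zero, zero_add]
  swap
  · intro n hn
    rw [poch_inv_zero hq (by simpa using hn)]; simp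
  have hMN := poch_ne_le hN (show M ≤ k + M by omega)
  have hA2 : poch q (a * q ^ (2*k)) (2*M+1) ≠ 0 := by
    have h := poch_add q a (2*k) (2*M+1)
    rw [show 2*k + (2*M+1) = 2*(k+M)+1 by ring] at h
    rw [h] at hA
    exact right_ne_zero_of_mul hA
  have key := vwp q (c3 * q ^ (l+1)) M hMN (a * q ^ (2*k)) hA2
  rw [anti_range M (fun m r => B q m r * ((-1)^m * T q m * (1 - a * q ^ (2*k) * q ^ (2*m)) *
    poch q (a * q ^ (2*k) * (c3 * q ^ (l+1)) * q ^ M) m * poch q (c3 * q ^ (l+1)) r /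
    poch q (a * q ^ (2*k) * q ^ m) (M+1)))] at key
  have hqk := pow_ne_zero k hq
  have hTk := T_ne hq k
  have hD : c3 * q ^ (l+1) ≠ 0 := mul_ne_zero h3 (pow_ne_zero _ hq)
  have s2 : ((-1:ℂ) ^ k) ^ 2 = 1 := by rw [← pow_mul, mul_comm, pow_mul]; norm_num
  have hTs := T_sq q k
  calc _ = poch q q (k+M) / poch q q M * (q^k)⁻¹ * poch q b (k+l) * poch q (q*c3) l *
        ∑ m ∈ range (M+1), B q m (M-m) * ((-1)^m * T q m * (1 - a * q ^ (2*k) * q ^ (2*m)) *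
        poch q (a * q ^ (2*k) * (c3 * q ^ (l+1)) * q ^ M) m * poch q (c3 * q ^ (l+1)) (M-m) /
        poch q (a * q ^ (2*k) * q ^ m) (M+1)) := by
        rw [mul_sum]
        refine sum_congr rfl fun m hm => ?_
        have hm : m ≤ M := by simpa [Nat.lt_succ_iff] using hm
        obtain ⟨r, rfl⟩ := Nat.exists_eq_add_of_le hm
        rw [show k + (m + r + 1) = k + (m + r) + 1 from rfl, show m + r - m = r by omega]
        have h1 : poch q b (k+m) * poch q (b * q ^ (k+m)) l
            = poch q b (k+l) * poch q (a * q ^ (2*k) * (c3 * q ^ (l+1)) * q ^ (m+r)) m := by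
          rw [← poch_add, show a * q ^ (2*k) * (c3 * q ^ (l+1)) * q ^ (m+r) = b * q ^ (k+l) by
            rw [hb']; ring, ← poch_add]
          congr 1; ring
        have h2 : poch q (q*c3) r * poch q (c3 * q ^ (k + (m+r) + 1) * (q ^ (k+m))⁻¹) l
            = poch q (q*c3) l * poch q (c3 * q ^ (l+1)) r := by
          rw [show c3 * q ^ (k + (m+r) + 1) * (q ^ (k+m))⁻¹ = q * c3 * q ^ r by
            have := pow_ne_zero (k+m) hq
            field_simp
            ring, ← poch_add, show c3 * q ^ (l+1) = q * c3 * q ^ l by ring, ← poch_add, add_comm]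
        have h3 : poch q (a * q ^ (k+m)) (k + (m+r) + 1)
            = poch q (a * q ^ (k+m)) k * poch q (a * q ^ (2*k) * q ^ m) (m + r + 1) := by
          rw [show a * q ^ (2*k) * q ^ m = a * q ^ (k+m) * q ^ k by ring, ← poch_add]
          congr 1
        have h4 : poch q (a * q ^ (k+m)) k ≠ 0 := by
          have h := poch_add q a (k+m) k
          have h5 := poch_ne_le hA (show k + m + k ≤ 2*(k + (m+r)) + 1 by omega)
          rw [h] at h5
          exact right_ne_zero_of_mul h5
        have hm1 := poch_ne_le hN (show m ≤ k + (m+r) by omega)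
        have hm2 := poch_ne_le hN (show k + m ≤ k + (m+r) by omega)
        have hm3 := poch_ne_le hN (show r ≤ k + (m+r) by omega)
        have h6 := poch_inv hq m k hm1
        rw [add_comm m k] at h6
        rw [wt, h3, h6, show k + (m+r) - (k+m) = r by omega, B, B, T_add, show a * q ^ (2*(k+m)) = a * q ^ (2*k) * q ^ (2*m) by ring,
          add_mul, pow_add q (k*k), ← hTs, add_assoc k m r, pow_add (-1:ℂ) k m, mul_comm m k]
        calc _ = poch q q (k+(m+r)) / (poch q q (k+m) * poch q q r) *
             ((-1)^k * (-1)^m * (T q k * T q m * q ^ (k*m)) * (1 - a * q ^ (2*k) * q ^ (2*m)) *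
               (poch q b (k+m) * poch q (b * q ^ (k+m)) l) * (poch q (q*c3) r * poch q (c3 * q ^ (k + (m+r) + 1) * (q ^ (k+m))⁻¹) l) / (poch q (a * q ^ (k+m)) k * poch q (a * q ^ (2*k) * q ^ m) (m + r + 1))) *
               (poch q q (k+m) * (-1)^k * T q k / (poch q q m * (T q k * T q k * q ^ k * q ^ (k*m))) * poch q (a * q ^ (k+m)) k) := by ring
          _ = _ := by
            rw [h1, h2]
            have := pow_ne_zero (k*m) hq
            clear h1 h2 h3 h6 hA2 hA key hb' hTs hD
            generalize poch q (a * q ^ (k+m)) k = P1 at *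
            generalize poch q (a * q ^ (2*k) * q ^ m) (m + r + 1) = P2 at *
            generalize poch q (a * q ^ (2*k) * (c3 * q ^ (l+1)) * q ^ (m+r)) m = P3 at *
            generalize poch q (c3 * q ^ (l+1)) r = P4 at *
            generalize poch q (q * c3) l = P5 at *
            generalize 1 - a * q ^ (2*k) * q ^ (2*m) = P6 at *
            generalize q ^ (k*m) = P7 at *
            rw [inv_eq_one_div]
            by_cases hP2 : P2 = 0
            · simp [hP2]
            field_simp
            rw [s2]; ring
    _ = _ := by
        rw [key, add_comm k M, poch_inv hq M k hMN, T_add, add_mul, pow_add q (M*k), ← hTs,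
          pow_add (-(c3 * q ^ (l+1))) M k, neg_pow (c3 * q ^ (l+1)) k]
        have := pow_ne_zero (M*k) hq
        clear hA2 hA key hb' hTs
        generalize c3 * q ^ (l+1) = D at *
        generalize q ^ (M*k) = P7 at *
        generalize poch q (q * c3) l = P5 at *
        field_simp
        rw [s2]; ring

end qRS

namespace qRS
open qR Finset

lemma sum_ext_range (f : ℕ → ℂ) {m M : ℕ} (hm : m ≤ M) (h : ∀ k, m < k → f k = 0) :
    ∑ k ∈ range (m+1), f k = ∑ k ∈ range (M+1), f k := by
  refine sum_subset (fun k hk => ?_) (fun k _ hk => h k ?_)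
  · simp at hk ⊢; omega
  · simp at hk; omega

def Qs (q a b c1 C : ℂ) (N n x : ℕ) : ℂ :=
  ∑ k ∈ range (x+1), poch q ((q ^ n)⁻¹) k * poch q (a * q ^ n) k * poch q ((q ^ x)⁻¹) k *
    poch q C k * q ^ k / (poch q (q * c1) k * poch q b k * poch q ((q ^ N)⁻¹) k * poch q q k)

lemma step3 (q a b c1 c3 C : ℂ) (hq : q ≠ 0) (h1 : c1 ≠ 0) (h3 : c3 ≠ 0) (N x l : ℕ)
    (hx : x ≤ N) (hb' : b = a * (c3 * q ^ (N+1))) (hC : C = c1 * c3 * q ^ (x+1))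
    (hN : poch q q N ≠ 0) (hA : poch q a (2*N+1) ≠ 0) (hb : poch q b N ≠ 0)
    (hc1 : poch q (q * c1) N ≠ 0) (hc3 : poch q (q * c3) N ≠ 0) :
    ∑ n ∈ range (N+1), wt q a b c3 N n *
      (poch q (b * q ^ n) l * poch q (c3 * q ^ (N+1) * (q ^ n)⁻¹) l) * Qs q a b c1 C N n x
    = poch q (q*c3) l * poch q b l * (-(c3 * q))^N * (q ^ l) ^ N * T q N *
      (poch q ((c3 * q ^ x)⁻¹) x / poch q (q*c1) x) *
      ∑ r ∈ range (N+1), poch q ((q ^ x)⁻¹) r * poch q C r * q ^ r /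
        (poch q b r * poch q (q*c3) r * poch q q r) * poch q ((q ^ l)⁻¹) r := by
  have hqx := pow_ne_zero x hq
  have hql := pow_ne_zero l hq
  have e1 : C * (c3 * q ^ x)⁻¹ = q * c1 := by rw [hC, pow_succ]; field_simp
  have key := tr3 q C ((c3 * q ^ x)⁻¹) b hq N x l hx hN hb
    (by rw [e1]; exact poch_ne_le hc1 hx)
  rw [e1] at key
  calc _ = ∑ k ∈ range (x+1), poch q ((q ^ x)⁻¹) k *
        poch q C k * q ^ k / (poch q (q * c1) k * poch q b k * poch q ((q ^ N)⁻¹) k * poch q q k)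
        * ∑ n ∈ range (N+1), wt q a b c3 N n *
      ((poch q (b * q ^ n) l * poch q (c3 * q ^ (N+1) * (q ^ n)⁻¹) l) *
       (poch q ((q^n)⁻¹) k * poch q (a * q ^ n) k)) := by
        simp only [Qs, mul_sum]
        rw [sum_comm]
        refine sum_congr rfl fun k _ => sum_congr rfl fun n _ => ?_
        ring
    _ = poch q (q*c3) l * poch q b l * (-(c3 * q))^N * (q ^ l) ^ N * T q N *
        ∑ k ∈ range (x+1), poch q ((q ^ x)⁻¹) k * poch q C k * poch q (b * q ^ l) k
        / (poch q (q * c1) k * poch q b k * poch q q k) * ((c3 * q ^ x)⁻¹ * q ^ x * (q ^ l)⁻¹) ^ k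
        := by
        rw [mul_sum]
        refine sum_congr rfl fun k hk => ?_
        have hk : k ≤ x := by simpa [Nat.lt_succ_iff] using hk
        have hk' := hk.trans hx
        rw [Wlem q a b c3 hq h3 N k l hk' hb' hN hA, add_comm k l, poch_add]
        have n1 := poch_ne_le hN hk'
        have n2 := poch_ne_le hb hk'
        have n3 := poch_ne_le hc1 hk'
        have n4 := poch_inv_ne hq hN hk'
        have e2 : (c3 * q ^ x)⁻¹ * q ^ x * (q ^ l)⁻¹ = (c3 * q ^ l)⁻¹ := by field_simp
        have e3 : (-(c3 * q ^ (l+1)))^N = (-(c3 * q))^N * (q ^ l) ^ N := by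
          rw [← mul_pow]; congr 1; ring
        have e4 : (c3 * q ^ (l+1)) ^ k = (c3 * q ^ l) ^ k * q ^ k := by
          rw [← mul_pow]; congr 1; ring
        rw [e2, e3, e4, inv_pow]
        have n5 := pow_ne_zero k (mul_ne_zero h3 hql)
        have n6 := pow_ne_zero k hq
        clear key e1 hb' hC hb hc1 hc3 hA e2 e3 e4
        generalize poch q (q*c1) k = P1 at *
        generalize poch q (q*c3) l = P2 at *
        generalize poch q (b*q^l) k = P3 at *
        generalize poch q ((q^N)⁻¹) k = P4 at *
        generalize poch q ((q^x)⁻¹) k = P5 at *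
        generalize (c3 * q ^ l) ^ k = P6 at *
        generalize (-(c3 * q)) ^ N = P7 at *
        generalize (q ^ l) ^ N = P8 at *
        field_simp
    _ = _ := by
        rw [key, mul_assoc _ (_ / _), mul_sum (a := poch q ((c3 * q ^ x)⁻¹) x / poch q (q*c1) x)]
        congr 1
        refine sum_congr rfl fun r hr => ?_
        have hr : r ≤ N := by simpa [Nat.lt_succ_iff] using hr
        by_cases hrx : x < r
        · rw [poch_inv_zero hq hrx]; simp
        obtain ⟨m, rfl⟩ := Nat.exists_eq_add_of_le' (not_lt.mp hrx)
        rw [Nat.add_sub_cancel]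
        have n1 := poch_ne_le hN hr
        have n2 := poch_ne_le hb hr
        have n3 := poch_ne_le hc1 hx
        have n4 := poch_ne_le hc3 hr
        have r4 : poch q ((c3 * q ^ (m+r))⁻¹) (m + r)
            = poch q ((c3 * q ^ (m+r))⁻¹) m *
              (poch q (q*c3) r * (-1)^r / (c3 ^ r * T q (r+1))) := by
          rw [poch_add, ← poch_rev hq h3 r]
          congr 2
          have := pow_ne_zero r hq
          have := pow_ne_zero m hq
          rw [pow_add]; field_simp
        have e2 : (c3 * q ^ (m+r))⁻¹ * q ^ (m+r) = c3⁻¹ := by field_simp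
        rw [e2, r4, ← T_sq, inv_pow, T_succ]
        have := T_ne hq r
        have := pow_ne_zero r hq
        clear key e1 hb' hC hb hc1 hc3 hA e2 r4
        generalize poch q (q*c1) (m+r) = P1 at *
        generalize poch q (q*c3) r = P2 at *
        generalize poch q ((q^l)⁻¹) r = P4 at *
        generalize poch q ((q^(m+r))⁻¹) r = P5 at *
        generalize poch q ((c3 * q^(m+r))⁻¹) m = P6 at *
        field_simp

lemma step4 (q b c3 A g : ℂ) (hq : q ≠ 0) (N i r : ℕ) (hi : i ≤ N) (hr : r ≤ N)
    (hg' : g * q ^ i = A * q ^ (N+1))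
    (hN : poch q q N ≠ 0) (hb : poch q b N ≠ 0)
    (hc3 : poch q (q * c3) N ≠ 0) (hg : poch q g N ≠ 0) :
    ∑ l ∈ range (i+1), poch q ((q ^ i)⁻¹) l * poch q A l * q ^ l
        / (poch q b l * poch q (q * c3) l * poch q g l * poch q q l) *
        (poch q (q * c3) l * poch q b l * (q ^ l) ^ N) * poch q ((q ^ l)⁻¹) r
    = poch q ((q ^ i)⁻¹) r * poch q A r / poch q ((q ^ N)⁻¹) r *
        (poch q q N / (poch q q (N-i) * poch q g i)) := by
  obtain ⟨M, rfl⟩ := Nat.exists_eq_add_of_le' hi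
  have hqi := pow_ne_zero i hq
  have e1 : A * (q * q ^ M) = g := by
    apply mul_right_cancel₀ hqi
    rw [hg']; ring
  have key := vandS q A (q * q ^ M) hq i r (poch_ne_le hN hi)
    (by rw [e1]; exact poch_ne_le hg hi)
  rw [e1] at key
  rw [Nat.add_sub_cancel]
  have n0 := poch_ne_le hN (show M ≤ M + i by omega)
  calc _ = _ := by
        refine sum_congr rfl fun l hl => ?_
        have hl : l ≤ M + i := by simp at hl; omega
        have n1 := poch_ne_le hN hl
        have n2 := poch_ne_le hb hl
        have n3 := poch_ne_le hc3 hl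
        have n4 := poch_ne_le hg hl
        have e3 : (q * q ^ M * q ^ i) ^ l = (q ^ l) ^ (M+i) * q ^ l := by ring
        show _ = poch q ((q ^ i)⁻¹) l * poch q A l / (poch q g l * poch q q l)
          * (q * q ^ M * q ^ i) ^ l * poch q ((q ^ l)⁻¹) r
        rw [e3]
        clear key e1 hb hc3
        generalize poch q (q*c3) l = P2 at *
        generalize poch q ((q^l)⁻¹) r = P4 at *
        generalize poch q ((q^i)⁻¹) l = P5 at *
        field_simp
    _ = _ := key
    _ = _ := by
        by_cases hri : i < r
        · rw [poch_inv_zero hq hri]; simp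
        obtain ⟨m, rfl⟩ := Nat.exists_eq_add_of_le' (not_lt.mp hri)
        rw [Nat.add_sub_cancel]
        have n1 := poch_ne_le hN (show M + m ≤ M + (m + r) by omega)
        have n4 := poch_ne_le hg hi
        have hx : poch q (q * q ^ M) m = poch q q (M+m) / poch q q M := by
          rw [poch_add q q M m]; field_simp
        have h7 := poch_inv hq (M + m) r n1
        rw [add_assoc] at h7
        rw [h7, hx, ← T_sq]
        have e3 : (q * q ^ M * q ^ (m+r)) ^ r = q ^ ((M+(m+r)) * r) * q ^ r := by ring
        rw [e3]
        have := T_ne hq r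
        have := pow_ne_zero r hq
        have := pow_ne_zero ((M+(m+r)) * r) hq
        have s1 : ((-1:ℂ) ^ r) ≠ 0 := pow_ne_zero _ (by norm_num)
        have s2 : ((-1:ℂ) ^ r) ^ 2 = 1 := by rw [← pow_mul, mul_comm, pow_mul]; norm_num
        clear key e1 hb hc3 hx h7 e3 hg'
        generalize poch q ((q^(m+r))⁻¹) r = P5 at *
        generalize q ^ ((M+(m+r)) * r) = P6 at *
        field_simp
        rw [s2, mul_one]

lemma core (q a b c1 c2 c3 C A g : ℂ) (hq : q ≠ 0) (h1 : c1 ≠ 0) (h2 : c2 ≠ 0) (h3 : c3 ≠ 0)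
    (N i x : ℕ) (hi : i ≤ N) (hx : x ≤ N) (hb' : b = a * (c3 * q ^ (N+1)))
    (hg' : g = c2 * c3 * q ^ (N+2)) (hC : C = c1 * c3 * q ^ (x+1)) (hA' : A = c2 * c3 * q ^ (i+1))
    (hN : poch q q N ≠ 0) (hA : poch q a (2*N+1) ≠ 0) (hb : poch q b N ≠ 0)
    (hc1 : poch q (q * c1) N ≠ 0) (hc2 : poch q (q * c2) N ≠ 0) (hc3 : poch q (q * c3) N ≠ 0)
    (hg : poch q g N ≠ 0) :
    ∑ n ∈ range (N+1), wt q a b c3 N n *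
      (∑ j ∈ range (i+1), poch q ((q ^ i)⁻¹) j * poch q A j *
        poch q ((q ^ n)⁻¹) j * poch q (a * q ^ n) j * q ^ j
      / (poch q (q * c2) j * poch q b j * poch q ((q ^ N)⁻¹) j * poch q q j))
      * Qs q a b c1 C N n x
    = (-(c3 * q)) ^ N * T q N * (poch q ((c3 * q ^ i)⁻¹) i / poch q (q * c2) i) *
      (poch q ((c3 * q ^ x)⁻¹) x / poch q (q*c1) x) *
      ∑ r ∈ range (N+1), poch q ((q ^ i)⁻¹) r * poch q A r * poch q ((q ^ x)⁻¹) r * poch q C r *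
        q ^ r / (poch q (q*c3) r * poch q b r * poch q ((q ^ N)⁻¹) r * poch q q r) := by
  subst hA'
  simp_rw [fun n => searsF q c2 c3 a b g hq h2 h3 N i n hi hb' hg' hN hb hc2 hc3 hg]
  set A := c2 * c3 * q ^ (i+1) with hA'
  set K := poch q g i * poch q ((c3 * q ^ i)⁻¹) i * poch q q (N - i) /
        (poch q (q * c2) i * poch q q N) with hK
  calc _ = K * ∑ l ∈ range (i+1), poch q ((q ^ i)⁻¹) l * poch q A l * q ^ l
        / (poch q b l * poch q (q * c3) l * poch q g l * poch q q l) *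
        ∑ n ∈ range (N+1), wt q a b c3 N n *
      (poch q (b * q ^ n) l * poch q (c3 * q ^ (N+1) * (q ^ n)⁻¹) l) * Qs q a b c1 C N n x := by
        simp only [mul_sum, sum_mul]
        rw [sum_comm]
        refine sum_congr rfl fun k _ => sum_congr rfl fun n _ => ?_
        ring
    _ = K * (((-(c3 * q)) ^ N * T q N * (poch q ((c3 * q ^ x)⁻¹) x / poch q (q*c1) x)) *
         ∑ r ∈ range (N+1), poch q ((q ^ x)⁻¹) r * poch q C r * q ^ r /
        (poch q b r * poch q (q*c3) r * poch q q r) *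
        ∑ l ∈ range (i+1), poch q ((q ^ i)⁻¹) l * poch q A l * q ^ l
        / (poch q b l * poch q (q * c3) l * poch q g l * poch q q l) *
        (poch q (q * c3) l * poch q b l * (q ^ l) ^ N) * poch q ((q ^ l)⁻¹) r) := by
        congr 1
        simp_rw [fun l => step3 q a b c1 c3 C hq h1 h3 N x l hx hb' hC hN hA hb hc1 hc3]
        simp only [mul_sum]
        rw [sum_comm]
        refine sum_congr rfl fun k _ => sum_congr rfl fun n _ => ?_
        ring
    _ = _ := by
        have n1 := poch_ne_le hN (show N - i ≤ N by omega)
        have n2 := poch_ne_le hg hi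
        have n3 := poch_ne_le hc2 hi
        have hKK : K * (poch q q N / (poch q q (N-i) * poch q g i))
          = poch q ((c3 * q ^ i)⁻¹) i / poch q (q * c2) i := by
          rw [hK]
          clear hb' hC hg' hg hb hc1 hc2 hc3 hA hA' hK
          generalize poch q ((c3 * q ^ i)⁻¹) i = P1 at *
          generalize poch q (q * c2) i = P2 at *
          generalize poch q q (N-i) = P3 at *
          field_simp
        rw [← hKK]
        simp only [mul_sum]
        refine sum_congr rfl fun r hr => ?_
        have hr : r ≤ N := by simpa [Nat.lt_succ_iff] using hr
        rw [← mul_sum, ← mul_sum, ← mul_sum, step4 q b c3 A g hq N i r hi hr (by rw [hg', hA']; ring) hN hb hc3 hg]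
        simp only [div_eq_mul_inv, mul_inv]
        ring

end qRS

namespace qRS
open qR Finset

lemma T_pow (q : ℂ) (n : ℕ) : q ^ ((n:ℤ) * ((n:ℤ)+1) / 2) = T q (n+1) := by
  have : (n:ℤ) * ((n:ℤ)+1) / 2 = ((n * (n+1) / 2 : ℕ) : ℤ) := by push_cast; rfl
  rw [this, zpow_natCast, T, prod_pow_eq_pow_sum, sum_range_id, Nat.add_sub_cancel, mul_comm]

lemma omxi (q c1 c2 t1 t2 : ℂ) (h1 : t1 ≠ 0) (h2 : t2 ≠ 0) (e1 : t1 ^ 2 = c1) (n : ℕ) :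
    om q (t1 * t2) (n:ℤ) / xi q c1 c2 t1 t2 (n:ℤ)
      = (-1)^n * c1 ^ n * T q (n+1) * poch q (q*c2) n / poch q (q*c1) n := by
  rw [om, xi, T_pow, zpow_natCast, zpow_natCast, zpow_natCast, Int.toNat_natCast, ← e1, div_pow,
    mul_pow, ← pow_mul, mul_comm 2 n, pow_mul]
  have := pow_ne_zero n h1
  have := pow_ne_zero n h2
  generalize poch q (q * t1^2) n = P1
  generalize poch q (q * c2) n = P2
  simp only [div_eq_mul_inv, mul_inv, inv_inv]
  field_simp

/-- natural-number form of the normalisation -/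
def Omn (q s c1 c2 c3 b t2 : ℂ) (N n : ℕ) : ℂ :=
  B q n (N-n) * (1 - c2 * c3 * q ^ (2*n+1)) * poch q (q*c2) n * poch q b n * poch q (q*c1) (N-n)
    * (s * t2)^N / ((q * c2)^n * poch q (c2 * c3 * q ^ (n+1)) (N+1) * poch q (q*c3) n)

lemma p_nat (q s c1 c2 c3 b t2 : ℂ) (N n x : ℕ) (hn : n ≤ N) (hx : x ≤ N)
    (hs : s ^ 2 = q) (h2 : t2 ^ 2 = c2) (hq : q ≠ 0) (hc2 : c2 ≠ 0)
    (hb : c1 * c2 * c3 * q ^ (N+2) = b) :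
    p q s c1 c2 c3 t2 (N:ℤ) (n:ℤ) (x:ℤ) = Omn q s c1 c2 c3 b t2 N n *
      ∑ k ∈ range (n+1), poch q ((q^n)⁻¹) k * poch q (c2 * c3 * q ^ (n+1)) k *
        poch q ((q^x)⁻¹) k * poch q (c1 * c2 * q ^ (x+1)) k * q ^ k
        / (poch q (q*c2) k * poch q b k * poch q ((q^N)⁻¹) k * poch q q k) := by
  have z1 : ∀ m : ℕ, q ^ ((m:ℤ)+1) = q ^ (m+1) := fun m => by exact_mod_cast zpow_natCast q (m+1)
  have z2 : q ^ ((N:ℤ)+2) = q ^ (N+2) := by exact_mod_cast zpow_natCast q (N+2)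
  have z3 : q ^ (2*(n:ℤ)+1) = q ^ (2*n+1) := by exact_mod_cast zpow_natCast q (2*n+1)
  have z4 : ((N:ℤ) - (n:ℤ)).toNat = N - n := by omega
  have z5 : ((N:ℤ) + 1).toNat = N + 1 := by omega
  have hst : s * t2 ≠ 0 := by
    apply mul_ne_zero
    · rintro rfl; apply hq; rw [← hs]; norm_num
    · rintro rfl; apply hc2; rw [← h2]; norm_num
  have z6 : (s * t2) ^ (2 * (n:ℤ) - (N:ℤ)) = (q * c2)^n / (s*t2)^N := by
    rw [zpow_sub₀ hst, zpow_natCast, zpow_mul, zpow_natCast]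
    congr 2
    rw [← hs, ← h2, ← mul_pow]
    exact_mod_cast rfl
  rw [p, if_pos (by omega), Om, binom, if_pos (by omega), Omn, B]
  simp only [z1, z2, z3, z4, z5, z6, hb, zpow_neg, zpow_natCast, Int.toNat_natCast]
  rw [Nat.add_sub_cancel' hn]
  congr 1
  have := pow_ne_zero N hst
  simp only [div_eq_mul_inv, mul_inv, inv_inv]
  ring

lemma wt_eq (q s c1 c2 c3 a b t1 t2 : ℂ) (h1 : t1 ≠ 0) (h2 : t2 ≠ 0) (e1 : t1 ^ 2 = c1)
    (hq : q ≠ 0) (hc1 : c1 ≠ 0) (N n : ℕ) (ha : a = c1 * c2 * q)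
    (p1 : poch q (q*c1) n ≠ 0) (p2 : poch q (q*c2) n ≠ 0) :
    om q (t1 * t2) (n:ℤ) / xi q c1 c2 t1 t2 (n:ℤ) * Omn q s c3 c1 c2 b t1 N n
      = wt q a b c3 N n * (s * t1)^N := by
  rw [omxi q c1 c2 t1 t2 h1 h2 e1, Omn, wt, T_succ, mul_pow q c1 n,
    show c1 * c2 * q ^ (n+1) = a * q ^ n by rw [ha]; ring,
    show c1 * c2 * q ^ (2*n+1) = a * q ^ (2*n) by rw [ha]; ring]
  have := pow_ne_zero n hq
  have := pow_ne_zero n hc1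
  generalize poch q (q*c1) n = P1 at *
  generalize poch q (q*c2) n = P2 at *
  generalize poch q (q*c3) (N-n) = P3 at *
  generalize poch q (a * q ^ n) (N+1) = P4 at *
  rw [div_eq_mul_inv _ P4]
  simp only [mul_inv, div_eq_mul_inv]
  generalize P4⁻¹ = P5
  field_simp

lemma fin_eq (q s c1 c2 c3 b t1 t2 t3 : ℂ) (h2 : t2 ≠ 0) (h3 : t3 ≠ 0) (h1 : t1 ≠ 0)
    (e2 : t2 ^ 2 = c2) (e3 : t3 ^ 2 = c3) (es : s ^ 2 = q)
    (hq : q ≠ 0) (hc2 : c2 ≠ 0) (hc3 : c3 ≠ 0) (N i x : ℕ)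
    (p1 : poch q (q*c1) x ≠ 0) (p2 : poch q (q*c2) i ≠ 0) (p3 : poch q (q*c3) i ≠ 0)
    (p4 : poch q (q*c3) x ≠ 0) :
    (om q (t2 * t3) (i:ℤ) / xi q c2 c3 t2 t3 (i:ℤ)) *
    (om q (t3 * t1) (x:ℤ) / xi q c3 c1 t3 t1 (x:ℤ)) * Omn q s c1 c2 c3 b t2 N i * (s * t1)^N *
    ((-(c3 * q)) ^ N * T q N * (poch q ((c3 * q ^ i)⁻¹) i / poch q (q * c2) i) *
      (poch q ((c3 * q ^ x)⁻¹) x / poch q (q*c1) x))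
     = om q (s * t1 * t2 * t3) (N:ℤ) * Omn q s c1 c3 c2 b t3 N i := by
  rw [omxi q c2 c3 t2 t3 h2 h3 e2, omxi q c3 c1 t3 t1 h3 h1 e3, om, T_pow, zpow_natCast,
    zpow_natCast, T_succ q N, poch_rev hq hc3, poch_rev hq hc3, Omn, Omn, mul_comm c3 c2]
  have x1 : (s * t1)^N * (-(c3 * q)) ^ N * (s * t2)^N
    = (-1)^N * (s * t1 * t2 * t3)^N * q ^ N * (s * t3)^N := by
    rw [← mul_pow, ← mul_pow, ← mul_pow, ← mul_pow, ← mul_pow, ← e3]; congr 1; ring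
  have := T_ne hq (i+1)
  have := T_ne hq (x+1)
  have := pow_ne_zero i hq
  have := pow_ne_zero i hc2
  have := pow_ne_zero i hc3
  have := pow_ne_zero x hc3
  have s2 : ((-1:ℂ) ^ i) ^ 2 = 1 := by rw [← pow_mul, mul_comm, pow_mul]; norm_num
  have s3 : ((-1:ℂ) ^ x) ^ 2 = 1 := by rw [← pow_mul, mul_comm, pow_mul]; norm_num
  rw [mul_pow q c2, mul_pow q c3]
  generalize poch q (q*c1) (N-i) = P0 at *
  generalize poch q (q*c1) x = P1 at *
  generalize poch q (q*c2) i = P2 at *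
  generalize poch q (q*c3) i = P3 at *
  generalize poch q (q*c3) x = P4 at *
  generalize poch q (c2 * c3 * q ^ (i+1)) (N+1) = P5
  generalize T q (x+1) = P6 at *
  generalize T q (i+1) = P7 at *
  generalize 1 - c2 * c3 * q ^ (2*i+1) = P8 at *
  generalize (-1:ℂ)^i = P9 at *
  generalize (-1:ℂ)^x = P10 at *
  generalize c2 ^ i = P11 at *
  generalize c3 ^ i = P12 at *
  generalize c3 ^ x = P13 at *
  generalize q ^ i = P14 at *
  generalize (s * t1)^N = Y1 at *
  generalize (-(c3 * q)) ^ N = Y2 at *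
  generalize (s * t2)^N = Y3 at *
  generalize (s * t3)^N = Y4 at *
  generalize (s * t1 * t2 * t3)^N = Y5 at *
  generalize (-1:ℂ)^N = Y6 at *
  generalize q ^ N = Y7 at *
  generalize B q i (N-i) = Y8 at *
  generalize poch q b i = Y9 at *
  generalize T q N = Y0 at *
  clear e2 e3 es hq hc2 hc3 h1 h2 h3
  have a1 : (P10 * P13 * P6 * P1 / P4) * (P4 * P10 / (P13 * P6) / P1) = P10 ^ 2 := by
    field_simp
  have a2 : (P9 * P11 * P7 * P3 / P2) * (P3 * P9 / (P12 * P7) / P2) * (P2 / (P14 * P11 * P3))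
      = P9 ^ 2 * (P3 / (P2 * (P14 * P12))) := by
    field_simp
  rw [s3] at a1
  rw [s2, one_mul] at a2
  calc _ = ((P10 * P13 * P6 * P1 / P4) * (P4 * P10 / (P13 * P6) / P1)) *
        ((P9 * P11 * P7 * P3 / P2) * (P3 * P9 / (P12 * P7) / P2) * (P2 / (P14 * P11 * P3))) *
        (Y1 * Y2 * Y3) * (Y0 * Y8 * P8 * Y9 * P0 * P5⁻¹) := by
        clear a1 a2 s2 s3 x1
        simp only [div_eq_mul_inv, mul_inv]
        ring
    _ = _ := by
        rw [x1, a1, a2]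
        simp only [mul_inv, div_eq_mul_inv]
        ring

end qRS
/-- Racah relation for the normalized q-Racah polynomials. -/
theorem qRacah_racah_relation
    (N : ℕ) (q s c1 c2 c3 t1 t2 t3 : ℂ)
    (hq : q ≠ 0) (hc1 : c1 ≠ 0) (hc2 : c2 ≠ 0) (hc3 : c3 ≠ 0)
    (hs : s ^ 2 = q) (ht1 : t1 ^ 2 = c1) (ht2 : t2 ^ 2 = c2) (ht3 : t3 ^ 2 = c3)
    (hgen : ∀ e1 e2 e3 : ℕ, e1 ≤ 1 → e2 ≤ 1 → e3 ≤ 1 → 1 ≤ e1 + e2 + e3 →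
      ∀ k : ℤ, 1 ≤ k → k ≤ 2 * (N : ℤ) + 5 → c1 ^ e1 * c2 ^ e2 * c3 ^ e3 ≠ q ^ (-k))
    (hq1 : ∀ k : ℕ, 1 ≤ k → k ≤ N → q ^ k ≠ 1)
    (i x : ℤ) (hi0 : 0 ≤ i) (hiN : i ≤ (N : ℤ)) (hx0 : 0 ≤ x) (hxN : x ≤ (N : ℤ)) :
    ∑ n ∈ Finset.range (N + 1),
        qR.om q (t1 * t2) (n : ℤ) / qR.xi q c1 c2 t1 t2 (n : ℤ)
          * (qR.om q (t2 * t3) i / qR.xi q c2 c3 t2 t3 i)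
          * (qR.om q (t3 * t1) x / qR.xi q c3 c1 t3 t1 x)
          * qR.p q s c1 c2 c3 t2 (N : ℤ) i (n : ℤ)
          * qR.p q s c3 c1 c2 t1 (N : ℤ) (n : ℤ) x
      = qR.om q (s * t1 * t2 * t3) (N : ℤ) * qR.p q s c1 c3 c2 t3 (N : ℤ) i x := by
  lift i to ℕ using hi0
  lift x to ℕ using hx0
  have hi : i ≤ N := by exact_mod_cast hiN
  have hx : x ≤ N := by exact_mod_cast hxN
  have ne : ∀ e1 e2 e3 : ℕ, e1 ≤ 1 → e2 ≤ 1 → e3 ≤ 1 → 1 ≤ e1 + e2 + e3 →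
      ∀ m : ℕ, 1 ≤ m → m ≤ 2*N+5 → 1 - c1 ^ e1 * c2 ^ e2 * c3 ^ e3 * q ^ m ≠ 0 := by
    intro e1 e2 e3 h1 h2 h3 h m hm hm2 h0
    refine hgen e1 e2 e3 h1 h2 h3 h m (by exact_mod_cast hm) (by exact_mod_cast hm2) ?_
    rw [zpow_neg, zpow_natCast]
    exact eq_inv_of_mul_eq_one_left (sub_eq_zero.mp h0).symm
  have hN : qR.poch q q N ≠ 0 := by
    refine qRS.poch_ne fun t ht h0 => hq1 (t+1) (by omega) (by omega) ?_
    rw [pow_succ', ← sub_eq_zero.mp h0]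
  have pc1 : qR.poch q (q * c1) N ≠ 0 := by
    refine qRS.poch_ne fun t ht => ?_
    convert ne 1 0 0 (by omega) (by omega) (by omega) (by omega) (t+1) (by omega) (by omega) using 1
    ring
  have pc2 : qR.poch q (q * c2) N ≠ 0 := by
    refine qRS.poch_ne fun t ht => ?_
    convert ne 0 1 0 (by omega) (by omega) (by omega) (by omega) (t+1) (by omega) (by omega) using 1
    ring
  have pc3 : qR.poch q (q * c3) N ≠ 0 := by
    refine qRS.poch_ne fun t ht => ?_
    convert ne 0 0 1 (by omega) (by omega) (by omega) (by omega) (t+1) (by omega) (by omega) using 1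
    ring
  have pa : qR.poch q (c1 * c2 * q) (2*N+1) ≠ 0 := by
    refine qRS.poch_ne fun t ht => ?_
    convert ne 1 1 0 (by omega) (by omega) (by omega) (by omega) (t+1) (by omega) (by omega) using 1
    ring
  have pg : qR.poch q (c2 * c3 * q ^ (N+2)) N ≠ 0 := by
    refine qRS.poch_ne fun t ht => ?_
    convert ne 0 1 1 (by omega) (by omega) (by omega) (by omega) (N+2+t) (by omega) (by omega)
      using 1
    ring
  have pb : qR.poch q (c1 * c2 * c3 * q ^ (N+2)) N ≠ 0 := by
    refine qRS.poch_ne fun t ht => ?_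
    convert ne 1 1 1 (by omega) (by omega) (by omega) (by omega) (N+2+t) (by omega) (by omega)
      using 1
    ring
  have h1 : t1 ≠ 0 := by rintro rfl; apply hc1; rw [← ht1]; norm_num
  have h2 : t2 ≠ 0 := by rintro rfl; apply hc2; rw [← ht2]; norm_num
  have h3 : t3 ≠ 0 := by rintro rfl; apply hc3; rw [← ht3]; norm_num
  obtain ⟨b, hb⟩ : ∃ b, b = c1 * c2 * c3 * q ^ (N+2) := ⟨_, rfl⟩
  obtain ⟨a, ha⟩ : ∃ a, a = c1 * c2 * q := ⟨_, rfl⟩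
  rw [← hb] at pb
  rw [← ha] at pa
  have key := qRS.core q a b c1 c2 c3 (c1 * c3 * q ^ (x+1)) (c2 * c3 * q ^ (i+1))
    (c2 * c3 * q ^ (N+2)) hq hc1 hc2 hc3 N i x hi hx (by rw [hb, ha]; ring) rfl rfl rfl
    hN pa pb pc1 pc2 pc3 pg
  have fin := qRS.fin_eq q s c1 c2 c3 b t1 t2 t3 h2 h3 h1 ht2 ht3 hs hq hc2 hc3 N i x
    (qRS.poch_ne_le pc1 hx) (qRS.poch_ne_le pc2 hi) (qRS.poch_ne_le pc3 hi)
    (qRS.poch_ne_le pc3 hx)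
  rw [qRS.p_nat q s c1 c3 c2 b t3 N i x hi hx hs ht3 hq hc3 (by rw [hb]; ring), ← mul_assoc,
    ← fin, mul_assoc _ _ (Finset.sum _ _)]
  rw [qRS.sum_ext_range _ hi (fun k hk => by rw [qRS.poch_inv_zero hq hk]; simp)]
  rw [mul_comm c3 c2, ← key, Finset.mul_sum]
  refine Finset.sum_congr rfl fun n hn => ?_
  have hn : n ≤ N := by simpa [Nat.lt_succ_iff] using hn
  have hw := qRS.wt_eq q s c1 c2 c3 a b t1 t2 h1 h2 ht1 hq hc1 N n ha
    (qRS.poch_ne_le pc1 hn) (qRS.poch_ne_le pc2 hn)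
  rw [qRS.p_nat q s c1 c2 c3 b t2 N i n hi hn hs ht2 hq hc2 hb.symm,
    qRS.p_nat q s c3 c1 c2 b t1 N n x hn hx hs ht1 hq hc1 (by rw [hb]; ring)]
  have hQ : (∑ k ∈ Finset.range (n+1), qR.poch q ((q^n)⁻¹) k * qR.poch q (c1 * c2 * q ^ (n+1)) k *
        qR.poch q ((q^x)⁻¹) k * qR.poch q (c3 * c1 * q ^ (x+1)) k * q ^ k
        / (qR.poch q (q*c1) k * qR.poch q b k * qR.poch q ((q^N)⁻¹) k * qR.poch q q k))
      = qRS.Qs q a b c1 (c1 * c3 * q ^ (x+1)) N n x := by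
    rw [qRS.Qs, qRS.sum_ext_range _ hn (fun k hk => by rw [qRS.poch_inv_zero hq hk]; simp),
      qRS.sum_ext_range _ hx (fun k hk => by rw [qRS.poch_inv_zero hq hk]; simp),
      mul_comm c3 c1, show c1 * c2 * q ^ (n+1) = a * q ^ n by rw [ha]; ring]
  rw [hQ, show c1 * c2 * q ^ (n+1) = a * q ^ n by rw [ha]; ring]
  generalize qRS.Qs q a b c1 (c1 * c3 * q ^ (x+1)) N n x = Z1
  generalize Finset.sum (M := ℂ) (Finset.range (i+1)) _ = Z2
  linear_combination (qR.om q (t2 * t3) i / qR.xi q c2 c3 t2 t3 i) *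
    (qR.om q (t3 * t1) x / qR.xi q c3 c1 t3 t1 x) * qRS.Omn q s c1 c2 c3 b t2 N i * Z1 * Z2 * hw
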